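/- arXiv:2404.11059 — 3 statements merged into one kernel-verified Lean document; each statement's English description precedes it below -/
import Mathlib

section
/- Let l ≥ 2 and let q be a prime power. Let G be a finite almost simple group whose socle G₀ is isomorphic to PSp(2l, q), assumed nonabelian simple. Then G contains an abelian subgroup A such that G = A·G₀. -/
set_option linter.unusedSimpArgs false
set_option linter.unusedSectionVars false
set_option linter.deprecated false

namespace AbSp

variable {F V : Type*} [Field F] [AddCommGroup V] [Module F V]

/-- `ω` is a nondegenerate alternating form. -/
structure Form (ω : LinearMap.BilinForm F V) : Prop where
  alt : ∀ x, ω x x = 0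
  nd : ∀ x, (∀ y, ω x y = 0) → x = 0

namespace Form
variable {ω : LinearMap.BilinForm F V} (hω : Form ω)
include hω

lemma swap (x y : V) : ω y x = - ω x y := by
  have h := hω.alt (x + y)
  simp only [map_add, LinearMap.add_apply, hω.alt, zero_add, add_zero] at h
  linear_combination h

lemma swap0 {x y : V} (h : ω x y = 0) : ω y x = 0 := by rw [hω.swap, h, neg_zero]

lemma isRefl : ω.IsRefl := fun _ _ h => hω.swap0 h

lemma nondeg : ω.Nondegenerate :=
  ⟨fun x h => hω.nd x h, fun x h => hω.nd x fun y => hω.swap0 (h y)⟩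

lemma exists_pair {x : V} (hx : x ≠ 0) : ∃ y, ω y x = 1 := by
  by_contra hcon
  push Not at hcon
  apply hx
  apply hω.nd
  intro y
  by_contra hy
  apply hcon ((ω y x)⁻¹ • y)
  have : ω y x ≠ 0 := fun h => hy (hω.swap0 h)
  simp [this]

end Form

/-- The isometry group of a form. -/
def Sp (ω : LinearMap.BilinForm F V) : Subgroup (V ≃ₗ[F] V) where
  carrier := {s | ∀ x y, ω (s x) (s y) = ω x y}
  mul_mem' := by
    intro a b ha hb x y
    simp only [LinearEquiv.mul_apply]
    rw [ha, hb]
  one_mem' := by intro x y; rfl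
  inv_mem' := by
    intro a ha x y
    rw [← ha]
    have h (z : V) : a (a⁻¹ z) = z := by
      rw [← LinearEquiv.mul_apply, mul_inv_cancel]; rfl
    rw [h, h]

variable {ω : LinearMap.BilinForm F V}

lemma Sp.iso (s : Sp ω) (x y : V) : ω (s.1 x) (s.1 y) = ω x y := s.2 x y

@[simp] lemma Sp.mul_app (s t : Sp ω) (x : V) : (s * t).1 x = s.1 (t.1 x) := rfl
@[simp] lemma Sp.one_app (x : V) : (1 : Sp ω).1 x = x := rfl
@[simp] lemma Sp.inv_app (s : Sp ω) (x : V) : s⁻¹.1 (s.1 x) = x := by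
  rw [← Sp.mul_app, inv_mul_cancel, Sp.one_app]
@[simp] lemma Sp.app_inv (s : Sp ω) (x : V) : s.1 (s⁻¹.1 x) = x := by
  rw [← Sp.mul_app, mul_inv_cancel, Sp.one_app]

lemma Sp.ext {s t : Sp ω} (h : ∀ x, s.1 x = t.1 x) : s = t := by
  apply Subtype.ext
  exact LinearEquiv.ext h

lemma Sp.iso_left (s : Sp ω) (x y : V) : ω (s.1 x) y = ω x (s⁻¹.1 y) := by
  rw [← Sp.iso s x, Sp.app_inv]

lemma Sp.iso_right (s : Sp ω) (x y : V) : ω x (s.1 y) = ω (s⁻¹.1 x) y := by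
  rw [← Sp.iso s _ y, Sp.app_inv]

/-- The underlying linear map of a root element. -/
def Elin (ω : LinearMap.BilinForm F V) (v w : V) (c : F) : V →ₗ[F] V :=
  LinearMap.id + (c • ω.flip v + ω.flip w).smulRight v + (ω.flip v).smulRight w

lemma Elin_apply (v w : V) (c : F) (x : V) :
    Elin ω v w c x = x + (c * ω x v + ω x w) • v + ω x v • w := by
  simp [Elin]

lemma Elin_mul (hω : Form ω) {v w w' : V} (h : ω v w = 0) (h' : ω v w' = 0) (c c' : F) (x : V) :
    Elin ω v w c (Elin ω v w' c' x) = Elin ω v (w + w') (c + c' + ω w' w) x := by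
  simp only [Elin_apply, map_add, map_smul, LinearMap.add_apply, LinearMap.smul_apply, smul_eq_mul,
    hω.alt, h, h', hω.swap0 h', hω.swap0 h]
  module

/-- The root elements `x ↦ x + (c ω(x,v) + ω(x,w)) v + ω(x,v) w`. -/
def E (hω : Form ω) (v w : V) (h : ω v w = 0) (c : F) : Sp ω :=
  ⟨LinearEquiv.ofLinear (Elin ω v w c) (Elin ω v (-w) (-c))
    (by
      ext x
      simp only [LinearMap.comp_apply]
      rw [Elin_mul hω h (by simp [h])]
      simp [Elin_apply, hω.alt])
    (by
      ext x
      simp only [LinearMap.comp_apply]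
      rw [Elin_mul hω (by simp [h]) h]
      simp [Elin_apply, hω.alt]), by
    intro x y
    simp only [LinearEquiv.ofLinear_apply, Elin_apply, map_add, map_smul, LinearMap.add_apply,
      LinearMap.smul_apply, smul_eq_mul, hω.alt, h, hω.swap0 h]
    rw [hω.swap y v, hω.swap y w]
    ring⟩

variable (hω : Form ω)

lemma E_apply {v w : V} (h : ω v w = 0) (c : F) (x : V) :
    (E hω v w h c).1 x = x + (c * ω x v + ω x w) • v + ω x v • w := by
  simp [E, Elin_apply]

lemma E_mul {v w w' : V} (h : ω v w = 0) (h' : ω v w' = 0) (c c' : F) :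
    E hω v w h c * E hω v w' h' c' =
      E hω v (w + w') (by rw [map_add, h, h', add_zero]) (c + c' + ω w' w) :=
  Sp.ext fun x => Elin_mul hω h h' c c' x

lemma E_congr {v w v' w' : V} (h : ω v w = 0) (h' : ω v' w' = 0) {c c' : F}
    (hv : v = v') (hw : w = w') (hc : c = c') : E hω v w h c = E hω v' w' h' c' := by
  subst hv hw hc; rfl

lemma E_conj {v w : V} (h : ω v w = 0) (c : F) (s : Sp ω) :
    s * E hω v w h c * s⁻¹ = E hω (s.1 v) (s.1 w) (by rw [Sp.iso, h]) c := by
  apply Sp.ext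
  intro x
  simp only [Sp.mul_app, E_apply, map_add, map_smul, Sp.app_inv]
  rw [Sp.iso_right, Sp.iso_right]

/-- Transvections. -/
def T (v : V) (a : F) : Sp ω := E hω v 0 (map_zero _) a

lemma T_apply (v : V) (a : F) (x : V) : (T hω v a).1 x = x + (a * ω x v) • v := by
  simp [T, E_apply]

lemma T_conj (v : V) (a : F) (s : Sp ω) : s * T hω v a * s⁻¹ = T hω (s.1 v) a := by
  unfold T
  rw [E_conj]
  exact E_congr hω _ _ rfl (map_zero _) rfl

lemma T_mul (v : V) (a b : F) : T hω v a * T hω v b = T hω v (a + b) := by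
  unfold T
  rw [E_mul]
  exact E_congr hω _ _ rfl (by simp) (by simp)

lemma T_zero (v : V) : T hω v 0 = 1 := Sp.ext fun x => by simp [T_apply]

lemma T_smul (k : F) (v : V) (a : F) : T hω (k • v) a = T hω v (a * k ^ 2) := by
  apply Sp.ext
  intro x
  simp only [T_apply, map_smul, smul_eq_mul, smul_smul]
  congr 2
  ring

lemma E_one {v : V} (h : ω v 0 = 0) : E hω v 0 h 0 = 1 := Sp.ext fun x => by simp [E_apply]

lemma E_pow {v w : V} (h : ω v w = 0) (c : F) (n : ℕ) :
    E hω v w h c ^ n = E hω v ((n : F) • w) (by simp [h]) (n * c) := by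
  induction n with
  | zero =>
    rw [pow_zero, ← E_one hω (v := v) (map_zero _)]
    exact E_congr hω _ _ rfl (by simp) (by simp)
  | succ n ih =>
    rw [pow_succ, ih, E_mul]
    refine E_congr hω _ _ rfl ?_ ?_
    · push_cast; module
    · push_cast; simp [hω.alt]; ring

lemma T_inj_right {v : V} (hv : v ≠ 0) {a b : F} (h : T hω v a = T hω v b) : a = b := by
  obtain ⟨y, hy⟩ := hω.exists_pair hv
  have := congrArg (fun s : Sp ω => s.1 y) h
  simp only [T_apply, hy, mul_one, add_right_inj] at this
  exact smul_left_injective F hv this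

section fd
variable [FiniteDimensional F V]
include hω

lemma perp_sep (R : Submodule F V) {w : V} (hw : w ∉ R) :
    ∃ z, (∀ r ∈ R, ω r z = 0) ∧ ω w z ≠ 0 := by
  by_contra hcon
  push Not at hcon
  apply hw
  rw [← LinearMap.BilinForm.orthogonal_orthogonal hω.nondeg hω.isRefl R]
  rw [LinearMap.BilinForm.mem_orthogonal_iff]
  intro n hn
  rw [LinearMap.BilinForm.mem_orthogonal_iff] at hn
  exact hω.swap0 (hcon n fun r hr => hn r hr)

lemma witt_aux {R : Submodule F V} {w w' : V} (h : ∀ r ∈ R, ω r w = ω r w') (hk : ω w w' ≠ 0) :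
    ∃ s : Sp ω, (∀ r ∈ R, s.1 r = r) ∧ s.1 w = w' := by
  refine ⟨T hω (w' - w) (ω w w')⁻¹, ?_, ?_⟩
  · intro r hr
    rw [T_apply, map_sub, h r hr]; simp
  · rw [T_apply, map_sub, hω.alt]; simp [hk]

lemma witt_step {R : Submodule F V} {w w' : V} (h : ∀ r ∈ R, ω r w = ω r w')
    (hw : w ∉ R) (hw' : w' ∉ R) : ∃ s : Sp ω, (∀ r ∈ R, s.1 r = r) ∧ s.1 w = w' := by
  by_cases hk : ω w w' = 0
  · obtain ⟨z, hz, hwz⟩ := perp_sep hω R hw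
    obtain ⟨z', hz', hwz'⟩ := perp_sep hω R hw'
    have : ∃ y, (∀ r ∈ R, ω r y = 0) ∧ ω w y ≠ 0 ∧ ω w' y ≠ 0 := by
      by_cases h1 : ω w' z = 0
      · by_cases h2 : ω w z' = 0
        · refine ⟨z + z', fun r hr => by rw [map_add, hz r hr, hz' r hr, add_zero], ?_, ?_⟩
          · rwa [map_add, h2, add_zero]
          · rwa [map_add, h1, zero_add]
        · exact ⟨z', hz', h2, hwz'⟩
      · exact ⟨z, hz, hwz, h1⟩
    obtain ⟨y, hy, hwy, hwy'⟩ := this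
    obtain ⟨s, hs, hsw⟩ := witt_aux hω (R := R) (w := w) (w' := w + y)
      (fun r hr => by rw [map_add, hy r hr, add_zero]) (by rwa [map_add, hω.alt, zero_add])
    obtain ⟨t, ht, htw⟩ := witt_aux hω (R := R) (w := w + y) (w' := w')
      (fun r hr => by rw [map_add, hy r hr, add_zero, h r hr]) (by
        rw [map_add, LinearMap.add_apply, hk, zero_add, hω.swap]
        exact neg_ne_zero.mpr hwy')
    refine ⟨t * s, fun r hr => ?_, ?_⟩
    · rw [Sp.mul_app, hs r hr, ht r hr]
    · rw [Sp.mul_app, hsw, htw]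
  · exact witt_aux hω h hk

/-- Transitivity on nonzero vectors. -/
lemma trans1 {v v' : V} (hv : v ≠ 0) (hv' : v' ≠ 0) : ∃ s : Sp ω, s.1 v = v' := by
  obtain ⟨s, -, hs⟩ := witt_step hω (R := ⊥) (w := v) (w' := v')
    (by intro r hr; rw [(Submodule.mem_bot F).1 hr]; simp) (by simpa using hv) (by simpa using hv')
  exact ⟨s, hs⟩

/-- Transitivity on independent pairs with given product. -/
lemma trans2 {v w v' w' : V} (hv : v ≠ 0) (hv' : v' ≠ 0) (hw : w ∉ Submodule.span F {v})
    (hw' : w' ∉ Submodule.span F {v'}) (h : ω v w = ω v' w') :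
    ∃ s : Sp ω, s.1 v = v' ∧ s.1 w = w' := by
  obtain ⟨s, hs⟩ := trans1 hω hv hv'
  obtain ⟨t, ht, htw⟩ := witt_step hω (R := Submodule.span F {v'}) (w := s.1 w) (w' := w')
    (by
      intro r hr
      obtain ⟨a, rfl⟩ := Submodule.mem_span_singleton.1 hr
      simp only [map_smul, LinearMap.smul_apply]
      rw [← h, ← hs, Sp.iso]) (by
      intro hc
      obtain ⟨a, ha⟩ := Submodule.mem_span_singleton.1 hc
      apply hw
      rw [Submodule.mem_span_singleton]
      refine ⟨a, ?_⟩
      apply s.1.injective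
      rw [map_smul, hs, ha]) hw'
  exact ⟨t * s, by rw [Sp.mul_app, hs, ht _ (Submodule.mem_span_singleton_self _)],
    by rw [Sp.mul_app, htw]⟩

end fd
end AbSp


namespace AbSp
open Submodule

section ftpg
variable {F V : Type*} [Field F] [AddCommGroup V] [Module F V]

/-- A map on vectors inducing an embedding of projective spaces. -/
structure Col (F : Type*) {V : Type*} [Field F] [AddCommGroup V] [Module F V] (f : V → V) :
    Prop where
  zero : ∀ x, f x = 0 ↔ x = 0
  sp : ∀ x y z, x ∈ span F {y, z} ↔ f x ∈ span F {f y, f z}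
  dim : ∀ a b : V, ∃ z, z ∉ span F {a, b}

lemma ind3 {e x y : V} (he : e ≠ 0) (hx : x ∉ span F {e}) (hy : y ∉ span F {e, x}) {a b c : F}
    (h : a • x + b • y + c • e = 0) : a = 0 ∧ b = 0 ∧ c = 0 := by
  have hb : b = 0 := by
    by_contra hb
    apply hy
    rw [mem_span_pair]
    refine ⟨-(b⁻¹ * c), -(b⁻¹ * a), ?_⟩
    have : y = b⁻¹ • (b • y) := by rw [smul_smul, inv_mul_cancel₀ hb, one_smul]
    rw [this, show b • y = -(a • x) - c • e by linear_combination (norm := module) h]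
    module
  subst hb
  have ha : a = 0 := by
    by_contra ha
    apply hx
    rw [mem_span_singleton]
    refine ⟨-(a⁻¹ * c), ?_⟩
    have : x = a⁻¹ • (a • x) := by rw [smul_smul, inv_mul_cancel₀ ha, one_smul]
    rw [this, show a • x = - c • e by linear_combination (norm := module) h]
    module
  subst ha
  simpa [he] using h

lemma notmem_of_indep {x e : V} (he : e ≠ 0) (hx : x ∉ span F {e}) : e ∉ span F {x} := by
  intro h
  obtain ⟨a, ha⟩ := mem_span_singleton.1 h
  have ha0 : a ≠ 0 := by rintro rfl; simp at ha; exact he ha.symm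
  apply hx
  rw [mem_span_singleton]
  exact ⟨a⁻¹, by rw [← ha, smul_smul, inv_mul_cancel₀ ha0, one_smul]⟩

lemma smul_notmem {x e : V} {c : F} (hc : c ≠ 0) (hx : x ∉ span F {e}) : c • x ∉ span F {e} := by
  rwa [Submodule.smul_mem_iff _ hc]

namespace Col
variable {f : V → V} (hf : Col F f)
include hf

lemma sp1 (x y : V) : x ∈ span F {y} ↔ f x ∈ span F {f y} := by
  have := hf.sp x y y
  simpa using this

lemma smul_eq (x : V) {c : F} (hc : c ≠ 0) : ∃ k : F, k ≠ 0 ∧ f (c • x) = k • f x := by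
  have : f (c • x) ∈ span F {f x} := (hf.sp1 _ _).1 (smul_mem _ _ (mem_span_singleton_self _))
  obtain ⟨k, hk⟩ := mem_span_singleton.1 this
  by_cases hx : x = 0
  · subst hx
    exact ⟨1, one_ne_zero, by simp⟩
  refine ⟨k, ?_, hk.symm⟩
  rintro rfl
  rw [zero_smul] at hk
  have := (hf.zero _).1 hk.symm
  simp [hc, hx] at this

/-- `u` is the normalised representative of `f x`. -/
def Pg (F : Type*) {V : Type*} [Field F] [AddCommGroup V] [Module F V]
    (f : V → V) (e x u : V) : Prop :=
  (∃ k : F, k ≠ 0 ∧ u = k • f x) ∧ (∃ m : F, m ≠ 0 ∧ f (x + e) = m • (u + f e))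

lemma pg_exists {e x : V} (he : e ≠ 0) (hx : x ∉ span F {e}) : ∃ u, Pg F f e x u := by
  have h1 : f (x + e) ∈ span F {f x, f e} :=
    (hf.sp _ _ _).1 (add_mem (subset_span (by simp)) (subset_span (by simp)))
  obtain ⟨a, b, hab⟩ := mem_span_pair.1 h1
  have ha : a ≠ 0 := by
    rintro rfl
    have : f (x + e) ∈ span F {f e} := by
      rw [← hab]; simp [mem_span_singleton]
    rw [← hf.sp1] at this
    apply hx
    simpa using sub_mem this (mem_span_singleton_self e)
  have hb : b ≠ 0 := by
    rintro rfl
    have : f (x + e) ∈ span F {f x} := by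
      rw [← hab]; simp [mem_span_singleton]
    rw [← hf.sp1] at this
    apply notmem_of_indep he hx
    simpa using sub_mem this (mem_span_singleton_self x)
  refine ⟨(b⁻¹ * a) • f x, ⟨_, by simp [ha, hb], rfl⟩, b, hb, ?_⟩
  rw [← hab, smul_add, smul_smul, ← mul_assoc, mul_inv_cancel₀ hb, one_mul]

lemma ind2 {e x : V} (he : e ≠ 0) (hx : x ∉ span F {e}) {u : V} (hu : Pg F f e x u) {a b : F}
    (h : a • u + b • f e = 0) : a = 0 ∧ b = 0 := by
  obtain ⟨⟨k, hk, rfl⟩, -⟩ := hu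
  have he' : f e ≠ 0 := fun h => he ((hf.zero _).1 h)
  have hx' : f x ∉ span F {f e} := fun h => hx ((hf.sp1 _ _).2 h)
  have ha : a = 0 := by
    by_contra ha
    apply hx'
    rw [mem_span_singleton]
    refine ⟨-((a * k)⁻¹ * b), ?_⟩
    have hak : a * k ≠ 0 := mul_ne_zero ha hk
    have : f x = (a * k)⁻¹ • ((a * k) • f x) := by rw [smul_smul, inv_mul_cancel₀ hak, one_smul]
    rw [this, show (a * k) • f x = - b • f e by
      rw [smul_smul] at h; linear_combination (norm := module) h]
    module
  subst ha
  simpa [he'] using h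

lemma pg_unique {e x : V} (he : e ≠ 0) (hx : x ∉ span F {e}) {u u' : V} (hu : Pg F f e x u)
    (hu' : Pg F f e x u') : u = u' := by
  have hu0 := hu
  obtain ⟨⟨k, hk, rfl⟩, m, hm, h⟩ := hu
  obtain ⟨⟨k', hk', rfl⟩, m', hm', h'⟩ := hu'
  rw [h] at h'
  have := hf.ind2 he hx hu0 (a := m - m' * k' * k⁻¹) (b := m - m') (by
    have e1 : (m - m' * k' * k⁻¹) • k • f x = m • k • f x - m' • k' • f x := by
      rw [sub_smul, smul_smul (m' * k' * k⁻¹), mul_assoc, inv_mul_cancel₀ hk, mul_one, mul_smul]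
    rw [e1]
    linear_combination (norm := module) h')
  obtain ⟨h1, h2⟩ := this
  have h3 : m = m' := by linear_combination h2
  subst h3
  have : k = k' := by
    have h4 : m * (1 - k' * k⁻¹) = 0 := by linear_combination h1
    have h5 := (mul_eq_zero.1 h4).resolve_left hm
    field_simp at h5
    linear_combination h5
  rw [this]

lemma indg {e x y : V} (he : e ≠ 0) (hx : x ∉ span F {e}) (hy : y ∉ span F {e, x}) {u v : V}
    (hu : Pg F f e x u) (hv : Pg F f e y v) {a b c : F}
    (h : a • u + b • v + c • f e = 0) : a = 0 ∧ b = 0 ∧ c = 0 := by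
  obtain ⟨⟨k, hk, rfl⟩, -⟩ := hu
  obtain ⟨⟨k', hk', rfl⟩, -⟩ := hv
  have he' : f e ≠ 0 := fun h => he ((hf.zero _).1 h)
  have hx' : f x ∉ span F {f e} := fun h => hx ((hf.sp1 _ _).2 h)
  have hy' : f y ∉ span F {f e, f x} := fun h => hy ((hf.sp _ _ _).2 h)
  have := ind3 he' hx' hy' (a := a * k) (b := b * k') (c := c) (by
    rw [← h]; module)
  simpa [hk, hk'] using this

lemma not_mem_of_pair {e x y : V} (hy : y ∉ span F {e, x}) : y ∉ span F {e} :=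
  fun h => hy (span_mono (by simp) h)

lemma pg_add {e x y : V} (he : e ≠ 0) (hx : x ∉ span F {e}) (hy : y ∉ span F {e, x}) {u v : V}
    (hu : Pg F f e x u) (hv : Pg F f e y v) : Pg F f e (x + y) (u + v) := by
  have I := fun {a b c : F} => hf.indg he hx hy hu hv (a := a) (b := b) (c := c)
  obtain ⟨⟨k, hk, huk⟩, m, hm, h⟩ := hu
  obtain ⟨⟨k', hk', hvk⟩, m', hm', h'⟩ := hv
  have m1 : f (x + y + e) ∈ span F {f (x + e), f y} := by
    apply (hf.sp _ _ _).1
    rw [show x + y + e = (x + e) + y by abel]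
    exact add_mem (subset_span (by simp)) (subset_span (by simp))
  have m2 : f (x + y + e) ∈ span F {f (y + e), f x} := by
    apply (hf.sp _ _ _).1
    rw [show x + y + e = (y + e) + x by abel]
    exact add_mem (subset_span (by simp)) (subset_span (by simp))
  have m3 : f (x + y) ∈ span F {f x, f y} := by
    apply (hf.sp _ _ _).1
    exact add_mem (subset_span (by simp)) (subset_span (by simp))
  have m4 : f (x + y) ∈ span F {f (x + y + e), f e} := by
    apply (hf.sp _ _ _).1
    rw [mem_span_pair]
    exact ⟨1, -1, by module⟩
  have n1 : f (x + y + e) ≠ 0 := by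
    rw [Ne, hf.zero]
    intro h0
    have := ind3 he hx hy (a := 1) (b := 1) (c := 1) (by simpa using h0)
    exact one_ne_zero this.1
  have n2 : f (x + y) ≠ 0 := by
    rw [Ne, hf.zero]
    intro h0
    have := ind3 he hx hy (a := 1) (b := 1) (c := 0) (by simpa using h0)
    exact one_ne_zero this.1
  have hfx : f x = k⁻¹ • u := by rw [huk, smul_smul, inv_mul_cancel₀ hk, one_smul]
  have hfy : f y = k'⁻¹ • v := by rw [hvk, smul_smul, inv_mul_cancel₀ hk', one_smul]
  obtain ⟨a1, b1, e1⟩ := mem_span_pair.1 m1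
  obtain ⟨a2, b2, e2⟩ := mem_span_pair.1 m2
  obtain ⟨a3, b3, e3⟩ := mem_span_pair.1 m3
  obtain ⟨a4, b4, e4⟩ := mem_span_pair.1 m4
  rw [h, hfy] at e1
  rw [h', hfx] at e2
  rw [hfx, hfy] at e3
  have i1 := I (a := a1 * m - b2 * k⁻¹) (b := b1 * k'⁻¹ - a2 * m') (c := a1 * m - a2 * m') (by
    have := e1.trans e2.symm
    linear_combination (norm := module) this)
  have E1 : f (x + y + e) = (a1 * m) • (u + v + f e) := by
    rw [← e1]
    have : b1 * k'⁻¹ = a1 * m := by linear_combination i1.2.1 - i1.2.2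
    rw [smul_smul, smul_smul, this]
    module
  have am : a1 * m ≠ 0 := by
    intro h0
    rw [h0, zero_smul] at E1
    exact n1 E1
  rw [E1] at e4
  have i2 := I (a := a3 * k⁻¹ - a4 * (a1 * m)) (b := b3 * k'⁻¹ - a4 * (a1 * m))
    (c := - (a4 * (a1 * m)) - b4) (by
    have := e3.trans e4.symm
    linear_combination (norm := module) this)
  have E2 : f (x + y) = (a4 * (a1 * m)) • (u + v) := by
    rw [← e3, smul_smul, smul_smul]
    rw [show a3 * k⁻¹ = a4 * (a1 * m) by linear_combination i2.1,
      show b3 * k'⁻¹ = a4 * (a1 * m) by linear_combination i2.2.1]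
    module
  have a4m : a4 * (a1 * m) ≠ 0 := by
    intro h0
    rw [h0, zero_smul] at E2
    exact n2 E2
  refine ⟨⟨(a4 * (a1 * m))⁻¹, inv_ne_zero a4m, ?_⟩, a1 * m, am, E1⟩
  rw [E2, smul_smul, inv_mul_cancel₀ a4m, one_smul]

lemma pg_smul {e x : V} {u v : V} {c : F} (hc : c ≠ 0)
    (hu : Pg F f e x u) (hv : Pg F f e (c • x) v) : ∃ t : F, t ≠ 0 ∧ v = t • u := by
  obtain ⟨⟨k, hk, huk⟩, m, hm, h⟩ := hu
  obtain ⟨⟨k', hk', hvk⟩, m', hm', h'⟩ := hv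
  obtain ⟨l, hl, hle⟩ := hf.smul_eq x hc
  refine ⟨k' * l * k⁻¹, by simp [hk, hk', hl], ?_⟩
  rw [hvk, hle, huk, smul_smul, smul_smul, mul_assoc, inv_mul_cancel₀ hk, mul_one]

lemma pair_smul {e x y : V} {c : F} (hc : c ≠ 0) (hy : y ∉ span F {e, x}) :
    c • y ∉ span F {e, c • x} := by
  rw [Submodule.smul_mem_iff _ hc]
  intro h
  apply hy
  obtain ⟨a, b, hab⟩ := mem_span_pair.1 h
  rw [mem_span_pair]
  exact ⟨a, b * c, by rw [← hab]; module⟩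

lemma pg_same {e x y : V} (he : e ≠ 0) (hx : x ∉ span F {e}) (hy : y ∉ span F {e, x}) {u v : V}
    {c t : F} (hc : c ≠ 0) (hu : Pg F f e x u) (hcu : Pg F f e (c • x) (t • u))
    (hv : Pg F f e y v) : Pg F f e (c • y) (t • v) := by
  obtain ⟨v', hv'⟩ := hf.pg_exists he (smul_notmem hc (hf.not_mem_of_pair hy))
  obtain ⟨s, hs, rfl⟩ := hf.pg_smul hc hv hv'
  have h1 := hf.pg_add he hx hy hu hv
  have h2 := hf.pg_add he (smul_notmem hc hx) (hf.pair_smul hc hy) hcu hv'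
  rw [← smul_add] at h2
  obtain ⟨r, hr, hrr⟩ := hf.pg_smul hc h1 h2
  have := hf.indg he hx hy hu hv (a := t - r) (b := s - r) (c := 0) (by
    linear_combination (norm := module) hrr)
  have : t = s := by linear_combination this.1 - this.2.1
  rwa [this]

end Col

lemma exch {e x y : V} (hx : x ∉ span F {e}) (hy : y ∉ span F {e, x}) : x ∉ span F {e, y} := by
  intro h
  obtain ⟨a, b, hab⟩ := mem_span_pair.1 h
  by_cases hb : b = 0
  · subst hb
    apply hx
    rw [mem_span_singleton]
    exact ⟨a, by simpa using hab⟩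
  · apply hy
    rw [mem_span_pair]
    refine ⟨-(b⁻¹ * a), b⁻¹, ?_⟩
    rw [← hab]
    match_scalars
    · field_simp; ring
    · field_simp

open Classical in
theorem ftpg {f : V → V} (hf : Col F f) (ℓ : V →ₗ[F] F) {e : V} (hl : ℓ e = 1) :
    ∃ (τ : F →+* F) (A : V →+ V), (∀ c x, A (c • x) = τ c • A x) ∧
      ∀ x, ∃ k : F, k ≠ 0 ∧ f x = k • A x := by
  have he : e ≠ 0 := by rintro rfl; simp at hl
  have he' : f e ≠ 0 := fun h => he ((hf.zero _).1 h)
  obtain ⟨x0, hx0⟩ := hf.dim e e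
  have hx0 : x0 ∉ span F {e} := by simpa using hx0
  have : ∀ x, ∃ u, (x = 0 → u = 0) ∧ (x ∉ span F {e} → Col.Pg F f e x u) := by
    intro x
    by_cases hx : x ∉ span F {e}
    · obtain ⟨u, hu⟩ := hf.pg_exists he hx
      exact ⟨u, fun h => (hx (h ▸ zero_mem _)).elim, fun _ => hu⟩
    · exact ⟨0, fun _ => rfl, fun h => (hx h).elim⟩
  choose g hg0 hg using this
  have g0 : g 0 = 0 := hg0 0 rfl
  have : ∀ c : F, ∃ t : F, (c = 0 → t = 0) ∧ g (c • x0) = t • g x0 := by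
    intro c
    by_cases hc : c = 0
    · exact ⟨0, fun _ => rfl, by simp [hc, g0]⟩
    · obtain ⟨t, ht, hh⟩ := hf.pg_smul hc (hg _ hx0) (hg _ (smul_notmem hc hx0))
      exact ⟨t, fun h => (hc h).elim, hh⟩
  choose τ hτ0 hτ using this
  have τ0 : τ 0 = 0 := hτ0 0 rfl
  -- uniform scalars
  have same1 : ∀ c z, z ∉ span F {e, x0} → g (c • z) = τ c • g z := by
    intro c z hz
    by_cases hc : c = 0
    · simp [hc, g0, τ0]
    have hz1 := hf.not_mem_of_pair hz
    have := hf.pg_same he hx0 hz hc (hg _ hx0) (hτ c ▸ hg _ (smul_notmem hc hx0)) (hg _ hz1)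
    exact hf.pg_unique he (smul_notmem hc hz1) (hg _ (smul_notmem hc hz1)) this
  have same : ∀ c x, x ∉ span F {e} → g (c • x) = τ c • g x := by
    intro c x hx
    by_cases hxx : x ∈ span F {e, x0}
    · obtain ⟨z, hz⟩ := hf.dim e x0
      by_cases hc : c = 0
      · simp [hc, g0, τ0]
      have hz1 := hf.not_mem_of_pair hz
      have hxz : x ∉ span F {e, z} := by
        intro h
        have hz2 : z ∉ span F {e, x} := by
          intro h2
          apply hz
          refine span_le.2 ?_ h2
          intro y hy
          rcases hy with rfl | rfl
          · exact subset_span (by simp)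
          · exact hxx
        exact exch hx hz2 h
      have := hf.pg_same he hz1 hxz hc (hg _ hz1)
        (same1 c z hz ▸ hg _ (smul_notmem hc hz1)) (hg _ hx)
      exact hf.pg_unique he (smul_notmem hc hx) (hg _ (smul_notmem hc hx)) this
    · exact same1 c x hxx
  have gadd : ∀ x y, x ∉ span F {e} → y ∉ span F {e, x} → g (x + y) = g x + g y := by
    intro x y hx hy
    have hxy : x + y ∉ span F {e} := by
      intro h
      apply hy
      have := sub_mem (span_mono (by simp) h : x + y ∈ span F {e, x})
        (subset_span (by simp) : x ∈ span F {e, x})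
      simpa using this
    exact hf.pg_unique he hxy (hg _ hxy)
      (hf.pg_add he hx hy (hg _ hx) (hg _ (hf.not_mem_of_pair hy)))
  have gx0 : g x0 ≠ 0 := by
    obtain ⟨⟨k, hk, h⟩, -⟩ := hg _ hx0
    rw [h]
    simp only [ne_eq, smul_eq_zero, hk, false_or, hf.zero]
    rintro rfl
    exact hx0 (zero_mem _)
  have τ1 : τ 1 = 1 := by
    have := hτ 1
    rw [one_smul] at this
    have h2 : (1 : F) • g x0 = τ 1 • g x0 := by rwa [one_smul]
    exact (smul_left_injective F gx0 h2).symm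
  have τmul : ∀ a b, τ (a * b) = τ a * τ b := by
    intro a b
    by_cases hb : b = 0
    · simp [hb, τ0]
    apply smul_left_injective F gx0
    simp only
    rw [← hτ, mul_smul, same a _ (smul_notmem hb hx0), hτ, smul_smul]
  have τadd : ∀ a b, τ (a + b) = τ a + τ b := by
    intro a b
    obtain ⟨z, hz⟩ := hf.dim e x0
    have key : ∀ c w, w ∉ span F {e, x0} → g (c • x0 + w) = τ c • g x0 + g w := by
      intro c w hw
      by_cases hc : c = 0
      · simp [hc, τ0]
      rw [gadd _ _ (smul_notmem hc hx0), hτ]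
      intro h
      apply hw
      refine span_le.2 ?_ h
      intro y hy
      rcases hy with rfl | rfl
      · exact subset_span (by simp)
      · exact smul_mem _ _ (subset_span (by simp))
    have hz2 : b • x0 + z ∉ span F {e, x0} := by
      intro h
      apply hz
      have := sub_mem h (smul_mem _ b (subset_span (by simp) : x0 ∈ span F {e, x0}))
      simpa using this
    have h1 := key (a + b) z hz
    have h2 := key a (b • x0 + z) hz2
    rw [key b z hz, ← add_assoc, ← add_smul, h1] at h2
    apply smul_left_injective F gx0
    simp only
    linear_combination (norm := module) h2
  let τ' : F →+* F := { toFun := τ, map_one' := τ1, map_mul' := τmul, map_zero' := τ0,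
                        map_add' := τadd }
  -- the hyperplane
  have hW : ∀ x, ℓ x = 0 → x ≠ 0 → x ∉ span F {e} := by
    intro x hx hx0 h
    obtain ⟨a, rfl⟩ := mem_span_singleton.1 h
    simp [hl] at hx
    simp [hx] at hx0
  have gsmulW : ∀ c x, ℓ x = 0 → g (c • x) = τ c • g x := by
    intro c x hx
    by_cases h : x = 0
    · simp [h, g0]
    · exact same c x (hW x hx h)
  have gaddW : ∀ x y, ℓ x = 0 → ℓ y = 0 → g (x + y) = g x + g y := by
    intro x y hx hy
    by_cases h : x = 0
    · simp [h, g0]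
    by_cases hy2 : y ∈ span F {e, x}
    · obtain ⟨a, b, rfl⟩ := mem_span_pair.1 hy2
      have ha : a = 0 := by simpa [hl, hx] using hy
      subst ha
      rw [zero_smul, zero_add, show x + b • x = (1 + b) • x by module, gsmulW _ _ hx,
        gsmulW _ _ hx, τadd, τ1, add_smul, one_smul]
    · exact gadd x y (hW x hx h) hy2
  have hproj : ∀ x, ℓ (x - ℓ x • e) = 0 := by intro x; simp [hl]
  refine ⟨τ', { toFun := fun x => g (x - ℓ x • e) + τ (ℓ x) • f e
                map_zero' := by simp [g0, τ0]
                map_add' := ?_ }, ?_, ?_⟩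
  · intro x y
    rw [map_add, τadd, show x + y - (ℓ x + ℓ y) • e = (x - ℓ x • e) + (y - ℓ y • e) by module,
      gaddW _ _ (hproj x) (hproj y)]
    module
  · intro c x
    change g (c • x - ℓ (c • x) • e) + τ (ℓ (c • x)) • f e =
      τ c • (g (x - ℓ x • e) + τ (ℓ x) • f e)
    rw [map_smul, smul_eq_mul, τmul, show c • x - (c * ℓ x) • e = c • (x - ℓ x • e) by module,
      gsmulW _ _ (hproj x)]
    module
  · intro x
    change ∃ k : F, k ≠ 0 ∧ f x = k • (g (x - ℓ x • e) + τ (ℓ x) • f e)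
    obtain ⟨y, hy⟩ : ∃ y, y = x - ℓ x • e := ⟨_, rfl⟩
    have hly : ℓ y = 0 := by rw [hy]; exact hproj x
    obtain ⟨a, ha⟩ : ∃ a, a = ℓ x := ⟨_, rfl⟩
    have hxe : x = y + a • e := by rw [hy, ha]; module
    rw [← hy, ← ha, hxe]
    by_cases h0 : y = 0
    · subst h0
      by_cases a0 : a = 0
      · subst a0
        exact ⟨1, one_ne_zero, by simp [g0, τ0, hf.zero]⟩
      · obtain ⟨k, hk, h⟩ := hf.smul_eq e a0
        have : τ a ≠ 0 := (map_ne_zero τ').2 a0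
        refine ⟨k * (τ a)⁻¹, by simp [hk, this], ?_⟩
        rw [zero_add, h, g0, zero_add, smul_smul, mul_assoc, inv_mul_cancel₀ this, mul_one]
    · have hye := hW y hly h0
      by_cases a0 : a = 0
      · subst a0
        obtain ⟨⟨k, hk, h⟩, -⟩ := hg y hye
        refine ⟨k⁻¹, inv_ne_zero hk, ?_⟩
        rw [τ0, zero_smul, zero_smul, add_zero, add_zero, h, smul_smul, inv_mul_cancel₀ hk,
          one_smul]
      · have hta : τ a ≠ 0 := (map_ne_zero τ').2 a0
        obtain ⟨-, m, hm, h⟩ := hg (a⁻¹ • y) (smul_notmem (inv_ne_zero a0) hye)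
        obtain ⟨k, hk, hh⟩ := hf.smul_eq (a⁻¹ • y + e) a0
        have hti : τ a⁻¹ = (τ a)⁻¹ := map_inv₀ τ' a
        rw [h, gsmulW _ _ hly, hti] at hh
        refine ⟨k * m * (τ a)⁻¹, by simp [hk, hm, hta], ?_⟩
        rw [show y + a • e = a • (a⁻¹ • y + e) by
          rw [smul_add, smul_smul, mul_inv_cancel₀ a0, one_smul], hh]
        match_scalars
        · field_simp
        · field_simp

end ftpg
end AbSp


namespace AbSp
open Submodule

section stepA
variable {F V : Type*} [Field F] [AddCommGroup V] [Module F V]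
variable {ω : LinearMap.BilinForm F V} (hω : Form ω)

/-- The unipotent radical of the stabiliser of a point. -/
def Q (v : V) : Subgroup (Sp ω) where
  carrier := {s | ∃ (w : V) (h : ω v w = 0) (c : F), s = E hω v w h c}
  mul_mem' := by
    rintro a b ⟨w, h, c, rfl⟩ ⟨w', h', c', rfl⟩
    exact ⟨_, _, _, E_mul hω h h' c c'⟩
  one_mem' := ⟨0, map_zero _, 0, (E_one hω _).symm⟩
  inv_mem' := by
    rintro a ⟨w, h, c, rfl⟩
    refine ⟨-w, by simp [h], -c, ?_⟩
    rw [inv_eq_iff_mul_eq_one, E_mul, ← E_one hω (v := v) (map_zero _)]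
    exact E_congr hω _ _ rfl (by simp) (by simp [hω.alt])

lemma Q_isPGroup (p : ℕ) [CharP F p] (v : V) : IsPGroup p (Q hω v) := by
  rintro ⟨s, hs⟩
  refine ⟨1, ?_⟩
  apply Subtype.ext
  rw [pow_one, Subgroup.coe_pow, Subgroup.coe_one]
  change s ^ p = 1
  obtain ⟨w, h, c, rfl⟩ := hs
  rw [E_pow, ← E_one hω (v := v) (map_zero _)]
  exact E_congr hω _ _ rfl (by simp) (by simp)

lemma Q_norm {v : V} {s : Sp ω} (hs : s.1 v = v) {t : Sp ω} (ht : t ∈ Q hω v) :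
    s * t * s⁻¹ ∈ Q hω v := by
  obtain ⟨w, h, c, rfl⟩ := ht
  refine ⟨s.1 w, by rw [← hs, Sp.iso, h], c, ?_⟩
  rw [E_conj]
  exact E_congr hω _ _ hs rfl rfl

lemma E_eq_T {v : V} (k c : F) (h : ω v (k • v) = 0) : E hω v (k • v) h c = T hω v (c + 2 * k) := by
  apply Sp.ext
  intro x
  simp only [E_apply, T_apply, map_smul, smul_eq_mul]
  module

lemma E_eq {v w w' : V} {c c' : F} (hv : v ≠ 0) (h : ω v w = 0) (h' : ω v w' = 0)
    (he : E hω v w h c = E hω v w' h' c') : ∃ k : F, w' = w + k • v ∧ c = c' + 2 * k := by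
  obtain ⟨y, hy⟩ := hω.exists_pair hv
  have := congrArg (fun s : Sp ω => s.1 y) he
  simp only [E_apply, hy, mul_one, one_smul] at this
  have hk : w' = w + (c + ω y w - c' - ω y w') • v := by linear_combination (norm := module) -this
  refine ⟨_, hk, ?_⟩
  have h2 : ω y w' = ω y w + (c + ω y w - c' - ω y w') := by
    conv_lhs => rw [hk]
    simp [hy]
  linear_combination h2

lemma cent_Q [FiniteDimensional F V] {v : V} (hv : v ≠ 0) {z : Sp ω} (hz : z.1 v = v)
    (hc : ∀ w (h : ω v w = 0), z * E hω v w h 0 * z⁻¹ = E hω v w h 0) :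
    ∃ (w : V) (h : ω v w = 0) (c : F), z = E hω v w h c ∧ ((2 : F) ≠ 0 → w = 0) := by
  have key : ∀ w, ω v w = 0 → ∃ k : F, z.1 w = w + k • v ∧ 0 = 2 * k := by
    intro w h
    have h1 := hc w h
    rw [E_conj, E_congr hω (w := z.1 w) (w' := z.1 w) _ (by rw [← hz, Sp.iso, h]) hz rfl rfl] at h1
    obtain ⟨k, hk, hk2⟩ := E_eq hω hv _ _ h1.symm
    exact ⟨k, hk, by simpa using hk2⟩
  obtain ⟨y, hy⟩ := hω.exists_pair hv
  obtain ⟨r, hr⟩ : ∃ r, z.1 y = y + r := ⟨z.1 y - y, by abel⟩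
  have hvr : ω v r = 0 := by
    have := Sp.iso z v y
    rw [hz, hr, map_add] at this
    linear_combination this
  have hvy : ω v y = -1 := by rw [hω.swap, hy]
  have key2 : ∀ w, ω v w = 0 → z.1 w = w + ω w r • v := by
    intro w h
    obtain ⟨k, hk, -⟩ := key w h
    have := Sp.iso z w y
    rw [hk, hr] at this
    simp only [map_add, LinearMap.add_apply, map_smul, LinearMap.smul_apply, smul_eq_mul, hvy,
      hvr] at this
    rw [hk, show k = ω w r by linear_combination -this]
  have main : z = E hω v r hvr (-ω y r) := by
    apply Sp.ext
    intro x
    have hx : x = (x - ω x v • y) + ω x v • y := by abel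
    have h0 : ω v (x - ω x v • y) = 0 := by
      rw [map_sub, map_smul, hvy, hω.swap x v]; simp
    rw [hx, map_add, map_add, key2 _ h0, map_smul, map_smul, hr, E_apply, E_apply, hω.swap0 h0, hy]
    simp only [map_sub, map_smul, LinearMap.sub_apply, LinearMap.smul_apply, smul_eq_mul]
    module
  by_cases h2 : (2 : F) = 0
  · exact ⟨r, hvr, _, main, fun h => (h h2).elim⟩
  · have hr2 : r ∈ span F {v} := by
      by_contra hcon
      obtain ⟨w, hw, hw2⟩ := perp_sep hω _ hcon
      have hw1 := hw v (mem_span_singleton_self v)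
      obtain ⟨k, hk, hk2⟩ := key w hw1
      have hk0 : k = 0 := by
        rcases mul_eq_zero.1 hk2.symm with h | h
        · exact (h2 h).elim
        · exact h
      rw [key2 w hw1, hk0] at hk
      have : ω w r • v = 0 := by simpa using hk
      rw [smul_eq_zero] at this
      exact hw2 (hω.swap0 (this.resolve_right hv))
    obtain ⟨k, rfl⟩ := mem_span_singleton.1 hr2
    refine ⟨0, map_zero _, (-ω y (k • v)) + 2 * k, ?_, fun _ => rfl⟩
    rw [main, E_eq_T hω k]
    rfl

instance [Finite V] : Finite (Sp ω) :=
  Finite.of_injective (fun s : Sp ω => (s.1 : V → V)) fun s t h => Sp.ext fun x => congrFun h x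

/-- The data of the almost simple group. -/
structure Ctx {G : Type*} [Group G] (π : Sp ω →* G) : Prop where
  ker : ∀ s, π s = 1 ↔ ∃ c : F, ∀ x, s.1 x = c • x
  normal : π.range.Normal
  cent : ∀ g, (∀ s, g * π s = π s * g) → g = 1

variable {G : Type*} [Group G]

lemma sylow_data [Finite V] [FiniteDimensional F V] [Nontrivial V]
    (p : ℕ) [Fact p.Prime] [CharP F p] :
    ∃ (U : Sylow p (Sp ω)) (v : V), v ≠ 0 ∧ (∀ u ∈ U, u.1 v = v) ∧ (∀ a, T hω v a ∈ U) ∧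
      ∀ z ∈ U, (∀ u ∈ U, z * u = u * z) → ∃ (w : V) (h : ω v w = 0) (c : F),
        z = E hω v w h c ∧ ((2 : F) ≠ 0 → w = 0) := by
  obtain ⟨U⟩ : Nonempty (Sylow p (Sp ω)) := inferInstance
  obtain ⟨x, hx⟩ := exists_ne (0 : V)
  have hp : p ∣ Nat.card V := by
    have : addOrderOf x = p := addOrderOf_eq_prime (by
      rw [← Nat.cast_smul_eq_nsmul F, CharP.cast_eq_zero, zero_smul]) hx
    rw [← this]
    exact addOrderOf_dvd_natCard x
  obtain ⟨v, hv, hv0⟩ := U.isPGroup'.exists_fixed_point_of_prime_dvd_card_of_fixed_point (G := U) V hp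
    (a := 0) (by intro u; exact map_zero u.1.1)
  have hfix : ∀ u ∈ U, u.1 v = v := fun u hu => hv ⟨u, hu⟩
  have hQ : Q hω v ≤ U := by
    have h1 : IsPGroup p ((U : Subgroup (Sp ω)) ⊔ Q hω v : Subgroup (Sp ω)) := by
      apply IsPGroup.to_sup_of_normal_right' U.isPGroup' (Q_isPGroup hω p v)
      intro u hu
      rw [Subgroup.mem_normalizer_iff]
      intro t
      constructor
      · exact fun ht => Q_norm hω (hfix u hu) ht
      · intro ht
        have h2 : (u⁻¹).1 v = v := hfix _ (inv_mem hu)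
        have := Q_norm hω h2 ht
        simpa [mul_assoc] using this
    have := U.is_maximal' h1 le_sup_left
    rw [← this]
    exact le_sup_right
  refine ⟨U, v, hv0.symm, hfix, fun a => hQ ⟨0, map_zero _, a, rfl⟩, ?_⟩
  intro z hz hc
  apply cent_Q hω hv0.symm (hfix z hz)
  intro w h
  rw [hc _ (hQ ⟨w, h, 0, rfl⟩), mul_inv_cancel_right]

lemma stepA [Finite V] [FiniteDimensional F V] [Nontrivial V] [Finite G] {π : Sp ω →* G}
    (C : Ctx π) (p : ℕ) [Fact p.Prime] [CharP F p] (g : G) {v : V} (hv : v ≠ 0) :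
    ∃ v', v' ≠ 0 ∧ ∀ a : F, ∃ (w : V) (h : ω v' w = 0) (c : F),
      g * π (T hω v a) * g⁻¹ = π (E hω v' w h c) ∧ ((2 : F) ≠ 0 → w = 0) := by
  obtain ⟨U, v0, hv0, hfix, hT, hcent⟩ := sylow_data hω p
  have := C.normal
  have main : ∀ g : G, ∃ v', v' ≠ 0 ∧ ∀ a : F, ∃ (w : V) (h : ω v' w = 0) (c : F),
      g * π (T hω v0 a) * g⁻¹ = π (E hω v' w h c) ∧ ((2 : F) ≠ 0 → w = 0) := by
    intro g
    have hP := Sylow.normalizer_sup_eq_top (U.mapSurjective π.rangeRestrict_surjective)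
    rw [sup_comm] at hP
    have hg : g ∈ (⊤ : Subgroup G) := Subgroup.mem_top g
    rw [← hP, Subgroup.mem_sup_of_normal_left] at hg
    obtain ⟨_, ⟨s, rfl⟩, n, hn, rfl⟩ := hg
    have hn1 : ∀ u ∈ U, ∃ z ∈ U, n * π u * n⁻¹ = π z := by
      intro u hu
      rw [Subgroup.mem_normalizer_iff] at hn
      have := (hn (π u)).1 (by
        refine ⟨π.rangeRestrict u, ?_, rfl⟩
        exact ⟨u, hu, rfl⟩)
      obtain ⟨_, ⟨z, hz, rfl⟩, h⟩ := this
      exact ⟨z, hz, h.symm⟩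
    have hn2 : ∀ u ∈ U, ∃ z ∈ U, n * π z * n⁻¹ = π u := by
      intro u hu
      rw [Subgroup.mem_normalizer_iff] at hn
      have := (hn (n⁻¹ * π u * n)).2 (by
        refine ⟨π.rangeRestrict u, ?_, ?_⟩
        · exact ⟨u, hu, rfl⟩
        · simp [mul_assoc])
      obtain ⟨_, ⟨z, hz, rfl⟩, h⟩ := this
      refine ⟨z, hz, ?_⟩
      have h : π z = n⁻¹ * π u * n := h
      rw [h]; simp [mul_assoc]
    refine ⟨s.1 v0, by simpa using hv0, fun a => ?_⟩
    obtain ⟨z, hz, hz1⟩ := hn1 _ (hT a)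
    obtain ⟨w, h, c, hzE, hw⟩ := hcent z hz (by
      intro u hu
      obtain ⟨u', hu', hu2⟩ := hn2 u hu
      have hcomm : T hω v0 a * u' = u' * T hω v0 a := by
        have := T_conj hω v0 a u'
        rw [hfix _ hu'] at this
        rw [mul_inv_eq_iff_eq_mul] at this
        exact this.symm
      have h1 : π (z * u * z⁻¹ * u⁻¹) = 1 := by
        have h2 : π z * π u = π u * π z := by
          rw [← hz1, ← hu2]
          have h3 := congrArg π hcomm
          rw [map_mul, map_mul] at h3
          calc _ = n * (π (T hω v0 a) * π u') * n⁻¹ := by group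
            _ = _ := by rw [h3]; group
        simp only [map_mul, map_inv]
        rw [h2]; group
      rw [C.ker] at h1
      obtain ⟨k, hk⟩ := h1
      have h3 := hfix (z * u * z⁻¹ * u⁻¹) (mul_mem (mul_mem (mul_mem hz hu) (inv_mem hz)) (inv_mem hu))
      rw [hk] at h3
      have hk1 : k = 1 := by
        apply smul_left_injective F hv0
        simpa using h3
      have h4 : z * u * z⁻¹ * u⁻¹ = 1 := by
        apply Sp.ext
        intro x
        rw [hk, hk1, one_smul]; rfl
      rw [mul_inv_eq_one, mul_inv_eq_iff_eq_mul] at h4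
      exact h4)
    refine ⟨s.1 w, by rw [Sp.iso, h], c, ?_, fun h2 => by rw [hw h2, map_zero]⟩
    rw [← E_conj hω h c s, ← hzE, map_mul, map_mul, map_inv, ← hz1]
    group
  obtain ⟨s, hs⟩ := trans1 hω hv0 hv
  obtain ⟨v', hv', h⟩ := main (g * π s)
  refine ⟨v', hv', fun a => ?_⟩
  obtain ⟨w, hw, c, h1, h2⟩ := h a
  refine ⟨w, hw, c, ?_, h2⟩
  rw [← h1, ← hs, ← T_conj, map_mul, map_mul, map_inv]
  group

end stepA
end AbSp


namespace AbSp
open Submodule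

section stepC
variable {F V : Type*} [Field F] [AddCommGroup V] [Module F V]
variable {ω : LinearMap.BilinForm F V} (hω : Form ω)
variable {G : Type*} [Group G] {π : Sp ω →* G}

lemma Ctx.inj_fix (C : Ctx π) {s t : Sp ω} {x : V} (hx : x ≠ 0) (hs : s.1 x = x) (ht : t.1 x = x)
    (h : π s = π t) : s = t := by
  have h1 : π (s * t⁻¹) = 1 := by rw [map_mul, map_inv, h, mul_inv_cancel]
  obtain ⟨k, hk⟩ := (C.ker _).1 h1
  have h2 := hk x
  rw [Sp.mul_app] at h2
  have ht' : t⁻¹.1 x = x := by conv_lhs => rw [← ht, Sp.inv_app]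
  rw [ht', hs] at h2
  have hk1 : k = 1 := by
    apply smul_left_injective F hx
    simpa using h2.symm
  rw [← mul_inv_eq_one]
  apply Sp.ext
  intro y
  rw [hk, hk1, one_smul]; rfl

/-- The dimension is at least three. -/
def Dim3 (F V : Type*) [Field F] [AddCommGroup V] [Module F V] : Prop :=
  ∀ a b : V, ∃ z, z ∉ span F {a, b}

variable [FiniteDimensional F V]

lemma mem_span_pair_iff (hω : Form ω) (x y z : V) :
    x ∈ span F {y, z} ↔ ∀ u, ω y u = 0 → ω z u = 0 → ω x u = 0 := by
  constructor
  · intro h u hy hz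
    obtain ⟨a, b, rfl⟩ := mem_span_pair.1 h
    simp [hy, hz]
  · intro h
    by_contra hc
    obtain ⟨u, hu, hxu⟩ := perp_sep hω _ hc
    exact hxu (h u (hu y (subset_span (by simp))) (hu z (subset_span (by simp))))

lemma exists_perp (hω : Form ω) (hd : Dim3 F V) (v w : V) : ∃ x, x ≠ 0 ∧ ω v x = 0 ∧ ω w x = 0 := by
  obtain ⟨z, hz⟩ := hd v w
  obtain ⟨x, hx, hx2⟩ := perp_sep hω _ hz
  refine ⟨x, ?_, hx v (subset_span (by simp)), hx w (subset_span (by simp))⟩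
  rintro rfl
  simp at hx2

lemma T_fix {v x : V} (h : ω v x = 0) (a : F) : (T hω v a).1 x = x := by
  rw [T_apply, hω.swap0 h]; simp

lemma T_comm_iff (hd : Dim3 F V) (C : Ctx π) {v w : V} (hv : v ≠ 0) {a b : F} (ha : a ≠ 0)
    (hb : b ≠ 0) :
    π (T hω w b) * π (T hω v a) * (π (T hω w b))⁻¹ = π (T hω v a) ↔ ω v w = 0 := by
  rw [← map_inv, ← map_mul, ← map_mul, T_conj]
  constructor
  · intro h
    obtain ⟨x, hx, hvx, hwx⟩ := exists_perp hω hd v w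
    have h1 := C.inj_fix hx (T_fix hω (by rw [T_apply]; simp [hvx, hwx]) _) (T_fix hω hvx _) h
    have h2 := congrArg (fun s : Sp ω => s.1 v) h1
    beta_reduce at h2
    set u := (T hω w b).1 v with hu
    have hu0 : u ≠ 0 := by rw [hu]; simpa using hv
    rw [T_apply, T_apply, hω.alt] at h2
    simp only [mul_zero, zero_smul, add_zero, add_eq_left, smul_eq_zero, mul_eq_zero, ha, hu0,
      false_or, or_false] at h2
    rw [hu, T_apply] at h2
    simp only [map_add, map_smul, hω.alt, smul_eq_mul, mul_eq_zero, hb, zero_add, false_or,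
      or_self] at h2
    exact h2
  · intro h
    rw [T_fix hω (hω.swap0 h)]

lemma T_same (hd : Dim3 F V) (C : Ctx π) {v w : V} {a b : F} (ha : a ≠ 0)
    (h : π (T hω v a) = π (T hω w b)) : v ∈ span F {w} := by
  by_cases hv : v = 0
  · rw [hv]; exact zero_mem _
  obtain ⟨x, hx, hvx, hwx⟩ := exists_perp hω hd v w
  have h1 := C.inj_fix hx (T_fix hω hvx _) (T_fix hω hwx _) h
  obtain ⟨y, hy⟩ := hω.exists_pair hv
  have h2 := congrArg (fun s : Sp ω => s.1 y) h1
  simp only [T_apply, hy, mul_one, add_right_inj] at h2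
  rw [mem_span_singleton]
  refine ⟨a⁻¹ * (b * ω y w), ?_⟩
  rw [mul_smul, ← h2, smul_smul, inv_mul_cancel₀ ha, one_smul]

/-- Elements preserving the class of transvection groups. -/
def TP (hω : Form ω) (π : Sp ω →* G) (g : G) : Prop :=
  ∀ v, v ≠ 0 → ∃ v', v' ≠ 0 ∧ ∀ a, ∃ c, g * π (T hω v a) * g⁻¹ = π (T hω v' c)

omit [FiniteDimensional F V] in
lemma TP.mul {g h : G} (hg : TP hω π g) (hh : TP hω π h) : TP hω π (g * h) := by
  intro v hv
  obtain ⟨v', hv', h1⟩ := hh v hv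
  obtain ⟨v'', hv'', h2⟩ := hg v' hv'
  refine ⟨v'', hv'', fun a => ?_⟩
  obtain ⟨c, hc⟩ := h1 a
  obtain ⟨d, hd⟩ := h2 c
  refine ⟨d, ?_⟩
  rw [← hd, ← hc]; group

omit [FiniteDimensional F V] in
lemma TP.of_range (s : Sp ω) : TP hω π (π s) := by
  intro v hv
  refine ⟨s.1 v, by simpa using hv, fun a => ⟨a, ?_⟩⟩
  rw [← T_conj]; simp

omit [FiniteDimensional F V] in
lemma TP.inv [Finite G] {g : G} (hg : TP hω π g) : TP hω π g⁻¹ := by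
  have h : ∀ n : ℕ, TP hω π (g ^ n) := by
    intro n
    induction n with
    | zero => rw [pow_zero, ← map_one π]; exact TP.of_range hω 1
    | succ n ih => rw [pow_succ]; exact ih.mul hω hg
  rw [inv_eq_of_mul_eq_one_right (b := g ^ (orderOf g - 1)) ?_]
  · exact h _
  · rw [← pow_succ', Nat.sub_add_cancel (orderOf_pos g), pow_orderOf_eq_one]

/-- Semisimilitudes. -/
structure SS (ω : LinearMap.BilinForm F V) (A : V ≃+ V) (τ : F ≃+* F) (μ : F) : Prop where
  smul : ∀ c x, A (c • x) = τ c • A x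
  ne : μ ≠ 0
  form : ∀ x y, ω (A x) (A y) = μ * τ (ω x y)

/-- The conjugation action of `g` is induced by the semisimilitude `A`. -/
structure Acts (π : Sp ω →* G) (g : G) (A : V ≃+ V) (τ : F ≃+* F) (μ : F) : Prop extends
    SS ω A τ μ where
  conj : ∀ s s' : Sp ω, (∀ x, A (s.1 x) = s'.1 (A x)) → g * π s * g⁻¹ = π s'

lemma form_const (hω : Form ω) {A : V ≃+ V} {τ : F ≃+* F} (hA : ∀ (c : F) x, A (c • x) = τ c • A x)
    (hp : ∀ x y, ω x y = 0 → ω (A x) (A y) = 0) : ∃ μ, SS ω A τ μ := by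
  have h1 : ∀ x : V, ∃ m : F, ∀ y, ω (A x) (A y) = m * τ (ω x y) := by
    intro x
    by_cases hx : x = 0
    · exact ⟨0, by simp [hx]⟩
    obtain ⟨y0, hy0⟩ := hω.exists_pair hx
    refine ⟨ω (A x) (A (-y0)), fun y => ?_⟩
    have h0 : ω x (y + ω x y • y0) = 0 := by
      rw [map_add, map_smul, hω.swap y0 x, hy0]; simp
    have h2 := hp _ _ h0
    rw [map_add, map_add, hA, map_smul, smul_eq_mul] at h2
    rw [map_neg, map_neg]
    linear_combination h2
  choose m hm using h1
  have h2 : ∀ x y, ω x y ≠ 0 → m x = m y := by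
    intro x y hxy
    have h3 := hm x y
    have h4 := hm y x
    rw [hω.swap (A x) (A y), h3, hω.swap x y, map_neg] at h4
    have h5 : τ (ω x y) ≠ 0 := by simpa using hxy
    apply mul_right_cancel₀ h5
    linear_combination -h4
  have h3 : ∀ x y, x ≠ 0 → y ≠ 0 → m x = m y := by
    intro x y hx hy
    by_cases hxy : ω x y = 0
    · obtain ⟨z, hz⟩ := hω.exists_pair hx
      obtain ⟨z', hz'⟩ := hω.exists_pair hy
      by_cases h1 : ω z y = 0
      · by_cases h2' : ω z' x = 0
        · rw [← h2 (z + z') x (by simp [hz, h2']), ← h2 (z + z') y (by simp [hz', h1])]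
        · rw [← h2 z' x h2', h2 z' y (by simp [hz'])]
      · rw [← h2 z y h1, h2 z x (by simp [hz])]
    · exact h2 x y hxy
  by_cases hV : ∃ x : V, x ≠ 0
  · obtain ⟨x0, hx0⟩ := hV
    refine ⟨m x0, hA, ?_, ?_⟩
    · intro h0
      have : A x0 = 0 := by
        apply hω.nd
        intro y
        obtain ⟨y, rfl⟩ := A.surjective y
        rw [hm, h0, zero_mul]
      rw [map_eq_zero_iff A A.injective] at this
      exact hx0 this
    · intro x y
      by_cases hx : x = 0
      · simp [hx]
      · rw [hm x y, h3 x x0 hx hx0]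
  · push Not at hV
    refine ⟨1, hA, one_ne_zero, ?_⟩
    intro x y
    simp [hV x]

omit [FiniteDimensional F V] in
lemma scalar_of_span {φ : V →ₗ[F] V} (h : ∀ x, φ x ∈ span F {x}) : ∃ c : F, ∀ x, φ x = c • x := by
  obtain ⟨c, hc⟩ := LinearMap.exists_eq_smul_id_of_forall_notLinearIndependent (f := φ) (by
    intro x hx
    obtain ⟨c, hc⟩ := mem_span_singleton.1 (h x)
    rw [LinearIndependent.pair_iff] at hx
    have := (hx c (-1) (by rw [hc]; simp)).2
    simp at this)
  exact ⟨c, fun x => by rw [hc]; simp⟩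

theorem TP.acts [Finite F] [Finite V] [Finite G] (hd : Dim3 F V) (C : Ctx π) {g : G}
    (hg : TP hω π g) : ∃ A τ μ, Acts π g A τ μ := by
  classical
  have hg' := hg
  have hg2 : ∀ v, ∃ v', (v ≠ 0 → v' ≠ 0) ∧ (v = 0 → v' = 0) ∧
      ∀ a, ∃ c, g * π (T hω v a) * g⁻¹ = π (T hω v' c) := by
    intro v
    by_cases hv : v = 0
    · refine ⟨0, fun h => (h hv).elim, fun _ => rfl, fun a => ⟨0, ?_⟩⟩
      have h0 : T hω v a = 1 := Sp.ext fun x => by simp [T_apply, hv]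
      rw [h0, T_zero]; simp
    · obtain ⟨v', h1, h2⟩ := hg v hv
      exact ⟨v', fun _ => h1, fun h => (hv h).elim, h2⟩
  choose f hf0 hf0' c hc using hg2
  have hcne : ∀ v a, v ≠ 0 → a ≠ 0 → c v a ≠ 0 := by
    intro v a hv ha h0
    have h1 := hc v a
    rw [h0, T_zero, map_one, mul_inv_eq_one, mul_eq_left] at h1
    obtain ⟨x, hx, hvx, -⟩ := exists_perp hω hd v v
    have h2 := C.inj_fix hx (T_fix hω hvx a) (Sp.one_app x) (by rw [h1, map_one])
    rw [← T_zero hω v] at h2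
    exact ha (T_inj_right hω hv h2)
  have hperp : ∀ v w, ω v w = 0 ↔ ω (f v) (f w) = 0 := by
    intro v w
    by_cases hv : v = 0
    · rw [hf0' v hv, hv]; simp
    by_cases hw : w = 0
    · rw [hf0' w hw, hw]; simp
    rw [← T_comm_iff hω hd C hv one_ne_zero one_ne_zero,
      ← T_comm_iff hω hd C (hf0 v hv) (hcne v 1 hv one_ne_zero) (hcne w 1 hw one_ne_zero), ← hc, ← hc]
    constructor
    · intro h
      calc _ = g * (π (T hω w 1) * π (T hω v 1) * (π (T hω w 1))⁻¹) * g⁻¹ := by group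
        _ = _ := by rw [h]
    · intro h
      have h2 : g * (π (T hω w 1) * π (T hω v 1) * (π (T hω w 1))⁻¹) * g⁻¹ =
        g * π (T hω v 1) * g⁻¹ := by rw [← h]; group
      simpa using h2
  have hsurj : ∀ y, ∃ v, ∃ k : F, k ≠ 0 ∧ f v = k • y := by
    intro y
    by_cases hy : y = 0
    · exact ⟨0, 1, one_ne_zero, by rw [hf0' 0 rfl, hy, smul_zero]⟩
    obtain ⟨v, hv, h⟩ := (hg.inv hω) y hy
    obtain ⟨d, hd1⟩ := h 1
    have h1 : π (T hω (f v) (c v d)) = π (T hω y 1) := by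
      rw [← hc, ← hd1]; group
    have hd0 : c v d ≠ 0 := by
      intro h0
      rw [h0, T_zero] at h1
      obtain ⟨x, hx, hvx, -⟩ := exists_perp hω hd y y
      have h2 := C.inj_fix hx (Sp.one_app x) (T_fix hω hvx 1) h1
      rw [← T_zero hω y] at h2
      exact one_ne_zero (T_inj_right hω hy h2).symm
    obtain ⟨k, hk⟩ := mem_span_singleton.1 (T_same hω hd C hd0 h1)
    refine ⟨v, k, ?_, hk.symm⟩
    rintro rfl
    rw [zero_smul] at hk
    exact hf0 v hv hk.symm
  have hcol : Col F f := by
    refine ⟨?_, ?_, hd⟩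
    · intro x
      exact ⟨fun h => by by_contra hx; exact hf0 x hx h, hf0' x⟩
    · intro x y z
      rw [mem_span_pair_iff hω, mem_span_pair_iff hω]
      constructor
      · intro h u h1 h2
        obtain ⟨v, k, hk, hv⟩ := hsurj u
        have h3 : ∀ t, ω t u = 0 ↔ ω t (f v) = 0 := by
          intro t; rw [hv]; simp [hk]
        rw [h3, ← hperp] at h1 h2 ⊢
        exact h v h1 h2
      · intro h u
        rw [hperp y, hperp z, hperp x]
        exact h (f u)
  obtain ⟨e, he⟩ : ∃ e : V, e ≠ 0 := by
    obtain ⟨z, hz⟩ := hd 0 0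
    exact ⟨z, fun h => hz (by rw [h]; exact zero_mem _)⟩
  obtain ⟨y0, hy0⟩ := hω.exists_pair he
  obtain ⟨τ, A, hA, hfA⟩ := ftpg hcol (ω y0) hy0
  have hAinj : Function.Injective A := by
    rw [injective_iff_map_eq_zero]
    intro x hx
    by_contra h
    obtain ⟨k, -, hk⟩ := hfA x
    exact hf0 x h (by rw [hk, hx, smul_zero])
  let A' : V ≃+ V := AddEquiv.ofBijective A (Finite.injective_iff_bijective.1 hAinj)
  let τ' : F ≃+* F := RingEquiv.ofBijective τ (Finite.injective_iff_bijective.1 τ.injective)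
  have hA' : ∀ x, A' x = A x := fun _ => rfl
  have hperp2 : ∀ x y, ω x y = 0 → ω (A' x) (A' y) = 0 := by
    intro x y h
    rw [hperp] at h
    obtain ⟨k, hk0, hk⟩ := hfA x
    obtain ⟨k', hk0', hk'⟩ := hfA y
    rw [hk, hk'] at h
    rw [hA', hA']
    simpa [hk0, hk0'] using h
  obtain ⟨μ, hμ⟩ := form_const hω (A := A') (τ := τ') hA hperp2
  refine ⟨A', τ', μ, hμ, ?_⟩
  intro s s' hs
  obtain ⟨s'', hs''⟩ : ∃ s'', π s'' = g * π s * g⁻¹ := C.normal.conj_mem _ ⟨s, rfl⟩ g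
  rw [← hs'']
  have hsp : ∀ y, s''.1 y ∈ span F {s'.1 y} := by
    intro y
    obtain ⟨v, rfl⟩ := A'.surjective y
    by_cases hv : v = 0
    · simp [hv]
    rw [← hs]
    obtain ⟨k, hk0, hk⟩ := hfA v
    obtain ⟨k', hk0', hk'⟩ := hfA (s.1 v)
    have h1 := hc (s.1 v) 1
    have h2 : π (T hω (s''.1 (f v)) (c v 1)) = π (T hω (f (s.1 v)) (c (s.1 v) 1)) := by
      rw [← h1, ← T_conj, ← T_conj]
      simp only [map_mul, map_inv]
      rw [hs'', ← hc]
      group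
    obtain ⟨m, hm⟩ := mem_span_singleton.1 (T_same hω hd C (hcne v 1 hv one_ne_zero) h2)
    rw [hk, hk', map_smul] at hm
    rw [mem_span_singleton]
    refine ⟨k⁻¹ * (m * k'), ?_⟩
    rw [hA', hA', mul_smul, mul_smul, hm, smul_smul, inv_mul_cancel₀ hk0, one_smul]
  have hsc := scalar_of_span (φ := (s'⁻¹ * s'').1.toLinearMap) (by
    intro x
    obtain ⟨k, hk⟩ := mem_span_singleton.1 (hsp x)
    rw [mem_span_singleton]
    refine ⟨k, ?_⟩
    change _ = (s'⁻¹ * s'').1 x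
    rw [Sp.mul_app, ← hk, map_smul, Sp.inv_app])
  have h3 := (C.ker (s'⁻¹ * s'')).2 hsc
  rw [map_mul, map_inv, inv_mul_eq_one] at h3
  exact h3.symm

end stepC
end AbSp


namespace AbSp
open Submodule

section stepD
variable {F V : Type*} [Field F] [AddCommGroup V] [Module F V]
variable {ω : LinearMap.BilinForm F V} (hω : Form ω)
variable {G : Type*} [Group G] {π : Sp ω →* G}
variable {A A' B : V ≃+ V} {τ τ' : F ≃+* F} {μ μ' : F} {g g' : G}

lemma SS.symm_smul (h : SS ω A τ μ) (c : F) (x : V) : A.symm (c • x) = τ.symm c • A.symm x := by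
  apply A.injective
  rw [h.smul]; simp

lemma SS.conjSp (h : SS ω A τ μ) (s : Sp ω) : ∃ s' : Sp ω, ∀ x, A (s.1 x) = s'.1 (A x) := by
  let f : V ≃+ V := (A.symm.trans s.1.toAddEquiv).trans A
  have hf : ∀ x, f x = A (s.1 (A.symm x)) := fun _ => rfl
  let f' : V ≃ₗ[F] V := { f with
    map_smul' := by
      intro c x
      change f (c • x) = c • f x
      rw [hf, hf, h.symm_smul, map_smul, h.smul]; simp }
  have hf' : ∀ x, f' x = A (s.1 (A.symm x)) := fun _ => rfl
  refine ⟨⟨f', ?_⟩, ?_⟩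
  · intro x y
    rw [hf', hf', h.form, Sp.iso, ← h.form]; simp
  · intro x
    change _ = f' (A x)
    rw [hf']; simp

lemma SS.mul (h : SS ω A τ μ) (h' : SS ω A' τ' μ') :
    SS ω (A'.trans A) (τ * τ') (μ * τ μ') where
  smul c x := by simp [h.smul, h'.smul]
  ne := mul_ne_zero h.ne (by simpa using h'.ne)
  form x y := by simp [h.form, h'.form, mul_assoc]

lemma SS.inv (h : SS ω A τ μ) : SS ω A.symm τ⁻¹ (τ.symm μ⁻¹) where
  smul c x := h.symm_smul c x
  ne := by simpa using h.ne
  form x y := by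
    apply τ.injective
    have h1 := h.form (A.symm x) (A.symm y)
    have h2 : ∀ z, τ (τ⁻¹ z) = z := fun z => τ.apply_symm_apply z
    rw [map_mul, h2, τ.apply_symm_apply]
    simp only [AddEquiv.apply_symm_apply] at h1
    rw [h1, inv_mul_cancel_left₀ h.ne]

lemma Acts.mul (h : Acts π g A τ μ) (h' : Acts π g' A' τ' μ') :
    Acts π (g * g') (A'.trans A) (τ * τ') (μ * τ μ') := by
  refine ⟨h.toSS.mul h'.toSS, ?_⟩
  intro s s'' hs
  obtain ⟨s', hs'⟩ := h'.toSS.conjSp s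
  have h1 := h'.conj s s' hs'
  have h2 := h.conj s' s'' (by
    intro x
    obtain ⟨x, rfl⟩ := A'.surjective x
    rw [← hs']
    exact hs x)
  rw [← h2, ← h1]; group

lemma Acts.inv (h : Acts π g A τ μ) : Acts π g⁻¹ A.symm τ⁻¹ (τ.symm μ⁻¹) := by
  refine ⟨h.toSS.inv, ?_⟩
  intro s s' hs
  have h1 := h.conj s' s (by
    intro x
    have h2 := hs (A x)
    simp only [AddEquiv.symm_apply_apply] at h2
    rw [← h2]; simp)
  rw [← h1]; group

lemma SS.scale (h : SS ω A τ μ) {k : F} (hk : k ≠ 0) (hB : ∀ x, B x = k • A x) :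
    SS ω B τ (k ^ 2 * μ) where
  smul c x := by rw [hB, hB, h.smul, smul_comm]
  ne := mul_ne_zero (pow_ne_zero 2 hk) h.ne
  form x y := by simp only [hB, map_smul, LinearMap.smul_apply, h.form, smul_eq_mul]; ring

lemma Acts.scale (h : Acts π g A τ μ) {k : F} (hk : k ≠ 0) (hB : ∀ x, B x = k • A x) :
    Acts π g B τ (k ^ 2 * μ) := by
  refine ⟨h.toSS.scale hk hB, ?_⟩
  intro s s' hs
  apply h.conj
  intro x
  have h1 := hs x
  rw [hB, hB, map_smul] at h1
  exact smul_right_injective V hk h1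

lemma Acts.uniq (C : Ctx π) (h : Acts π g A τ μ) (h' : Acts π g' A' τ' μ') {k : F} (hk : k ≠ 0)
    (hA : ∀ x, A' x = k • A x) : g' = g := by
  have h1 : g⁻¹ * g' = 1 := by
    apply C.cent
    intro s
    obtain ⟨s', hs'⟩ := h.toSS.conjSp s
    have h1 := h.conj s s' hs'
    have h2 := h'.conj s s' (by intro x; rw [hA, hA, hs', map_smul])
    rw [← h2, mul_inv_eq_iff_eq_mul] at h1
    calc g⁻¹ * g' * π s = g⁻¹ * (g' * π s * g'⁻¹ * g) * g⁻¹ * g' := by group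
      _ = _ := by rw [← h1]; group
  rw [inv_mul_eq_one] at h1
  exact h1.symm

lemma Acts.of_range (s : Sp ω) : Acts π (π s) s.1.toAddEquiv 1 1 := by
  refine ⟨⟨?_, one_ne_zero, ?_⟩, ?_⟩
  · intro c x; simp
  · intro x y; simpa using Sp.iso s x y
  · intro t t' h
    rw [← map_inv, ← map_mul, ← map_mul]
    congr 1
    rw [mul_inv_eq_iff_eq_mul]
    apply Sp.ext
    intro x
    exact h x

lemma Acts.realize (h : Acts π g A τ μ) {r : F} (hr : r ≠ 0) (hB : SS ω B τ (r ^ 2 * μ)) :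
    ∃ s : Sp ω, Acts π (π s * g) B τ (r ^ 2 * μ) := by
  let f : V ≃+ V := (A.symm.trans B).trans
    (LinearEquiv.smulOfNeZero F V r⁻¹ (inv_ne_zero hr)).toAddEquiv
  have hf : ∀ x, f x = r⁻¹ • B (A.symm x) := fun _ => rfl
  let f' : V ≃ₗ[F] V := { f with
    map_smul' := by
      intro c x
      change f (c • x) = c • f x
      rw [hf, hf, h.toSS.symm_smul, hB.smul, smul_comm]; simp }
  have hf' : ∀ x, f' x = r⁻¹ • B (A.symm x) := fun _ => rfl
  let s : Sp ω := ⟨f', by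
    intro x y
    rw [hf', hf']
    simp only [map_smul, LinearMap.smul_apply, smul_eq_mul, hB.form]
    have h1 := h.form (A.symm x) (A.symm y)
    simp only [AddEquiv.apply_symm_apply] at h1
    rw [h1]
    field_simp⟩
  refine ⟨s, ?_⟩
  have h1 := ((Acts.of_range (π := π) s).mul h).scale (B := B) hr (by
    intro x
    change _ = r • f' (A x)
    rw [hf', smul_smul, mul_inv_cancel₀ hr, one_smul]; simp)
  simpa using h1

lemma Acts.mem_range (C : Ctx π) (h : Acts π g A 1 μ) {r : F} (hr : μ = r ^ 2) :
    ∃ s, g = π s := by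
  have hr0 : r ≠ 0 := by
    rintro rfl
    exact h.ne (by simpa using hr)
  have h1 := (Acts.of_range (π := π) 1).realize (B := A) hr0 (by rw [mul_one, ← hr]; exact h.toSS)
  obtain ⟨s, hs⟩ := h1
  exact ⟨s * 1, by rw [map_mul]; exact hs.uniq C h one_ne_zero (by simp)⟩

lemma Acts.pow (h : Acts π g A τ μ) (n : ℕ) : ∃ A' μ', Acts π (g ^ n) A' (τ ^ n) μ' := by
  induction n with
  | zero =>
    refine ⟨(1 : Sp ω).1.toAddEquiv, 1, ?_⟩
    rw [pow_zero, pow_zero, ← map_one π]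
    exact Acts.of_range 1
  | succ n ih =>
    obtain ⟨A', μ', h'⟩ := ih
    rw [pow_succ, pow_succ]
    exact ⟨_, _, h'.mul h⟩

lemma Acts.coset (C : Ctx π) (h : Acts π g A τ μ) (h' : Acts π g' A' τ μ') {r : F}
    (hr : μ = r ^ 2 * μ') : ∃ s, g = π s * g' := by
  have h1 := h.mul h'.inv
  rw [mul_inv_cancel] at h1
  obtain ⟨s, hs⟩ := h1.mem_range C (r := r) (by
    rw [τ.apply_symm_apply, hr, mul_assoc, mul_inv_cancel₀ h'.ne, mul_one])
  exact ⟨s, by rw [← hs]; group⟩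

/-- The group of field automorphisms that occur. -/
def autH (π : Sp ω →* G) : Subgroup (RingAut F) where
  carrier := {τ | ∃ g A μ, Acts π g A τ μ}
  mul_mem' := by
    rintro a b ⟨g, A, μ, h⟩ ⟨g', A', μ', h'⟩
    exact ⟨_, _, _, h.mul h'⟩
  one_mem' := ⟨_, _, _, Acts.of_range 1⟩
  inv_mem' := by
    rintro a ⟨g, A, μ, h⟩
    exact ⟨_, _, _, h.inv⟩

end stepD

lemma aut_frob (F : Type*) [Field F] [Finite F] (p : ℕ) [Fact p.Prime] [CharP F p] (τ : RingAut F) :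
    ∃ n : ℕ, τ = (frobeniusEquiv F p : RingAut F) ^ n := by
  let _ := ZMod.algebra F p
  have : Fintype F := Fintype.ofFinite F
  let σ : F ≃ₐ[ZMod p] F := AlgEquiv.ofRingEquiv (f := τ) (by
    intro r
    exact RingHom.congr_fun (Subsingleton.elim ((τ : F →+* F).comp (algebraMap (ZMod p) F))
      (algebraMap (ZMod p) F)) r)
  obtain ⟨n, hn⟩ := (FiniteField.bijective_frobeniusAlgEquivOfAlgebraic_pow (ZMod p) F).2 σ
  refine ⟨n.1, ?_⟩
  apply RingEquiv.ext
  intro x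
  have h1 := congrArg (fun f : F ≃ₐ[ZMod p] F => f x) hn
  have h2 : ∀ (m : ℕ) (x : F), (FiniteField.frobeniusAlgEquivOfAlgebraic (ZMod p) F ^ m) x =
      ((frobeniusEquiv F p : RingAut F) ^ m) x := by
    intro m
    induction m with
    | zero => intro x; rfl
    | succ m ih =>
      intro x
      rw [pow_succ, pow_succ, AlgEquiv.mul_apply, RingAut.mul_apply, ih]
      congr 1
      simp [frobeniusEquiv_apply, ZMod.card, frobenius_def]
  rw [← h2, ← show σ x = τ x from rfl]
  exact h1.symm

instance aut_cyclic (F : Type*) [Field F] [Finite F] : IsCyclic (RingAut F) := by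
  obtain ⟨p, hp⟩ := CharP.exists F
  have : Fact p.Prime := ⟨CharP.char_is_prime F p⟩
  exact ⟨frobeniusEquiv F p, fun τ => by
    obtain ⟨n, hn⟩ := aut_frob F p τ
    exact ⟨n, by rw [hn]; simp⟩⟩

lemma sq_of_nonsq {F : Type*} [Field F] [Finite F] {a b : F} (ha : ¬ IsSquare a)
    (hb : ¬ IsSquare b) : ∃ r, r ≠ 0 ∧ a = r ^ 2 * b := by
  classical
  have : Fintype F := Fintype.ofFinite F
  have ha0 : a ≠ 0 := by rintro rfl; exact ha (IsSquare.zero)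
  have hb0 : b ≠ 0 := by rintro rfl; exact hb (IsSquare.zero)
  have h2 : ringChar F ≠ 2 := fun h => ha (FiniteField.isSquare_of_char_two h a)
  have h1 := (quadraticChar_neg_one_iff_not_isSquare).2 ha
  have h3 := (quadraticChar_neg_one_iff_not_isSquare).2 hb
  have h4 : quadraticChar F (a * b) = 1 := by rw [map_mul, h1, h3]; norm_num
  obtain ⟨r, hr⟩ := (quadraticChar_one_iff_isSquare (mul_ne_zero ha0 hb0)).1 h4
  refine ⟨r / b, ?_, ?_⟩
  · apply div_ne_zero _ hb0
    rintro rfl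
    exact mul_ne_zero ha0 hb0 (by simpa using hr)
  · field_simp
    rw [hr]; ring

end AbSp


namespace AbSp
open Submodule

section std
variable {F : Type*} [Field F] {n : Type*} [Fintype n] [DecidableEq n]

/-- The standard symplectic form. -/
def stdForm (F : Type*) [Field F] (n : Type*) [Fintype n] : LinearMap.BilinForm F (n ⊕ n → F) :=
  LinearMap.mk₂ F (fun x y => ∑ i, (x (Sum.inr i) * y (Sum.inl i) - x (Sum.inl i) * y (Sum.inr i)))
    (by intro a b c; rw [← Finset.sum_add_distrib]; congr 1; ext i; simp; ring)
    (by intro a b c; rw [smul_eq_mul, Finset.mul_sum]; congr 1; ext i; simp; ring)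
    (by intro a b c; rw [← Finset.sum_add_distrib]; congr 1; ext i; simp; ring)
    (by intro a b c; rw [smul_eq_mul, Finset.mul_sum]; congr 1; ext i; simp; ring)

omit [DecidableEq n] in
lemma stdForm_apply (x y : n ⊕ n → F) : stdForm F n x y =
    ∑ i, (x (Sum.inr i) * y (Sum.inl i) - x (Sum.inl i) * y (Sum.inr i)) := rfl

lemma stdForm_form : Form (stdForm F n) where
  alt x := by rw [stdForm_apply]; apply Finset.sum_eq_zero; intro i _; ring
  nd x h := by
    funext j
    rcases j with j | j
    · have := h (Pi.single (Sum.inr j) 1)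
      rw [stdForm_apply] at this
      simpa [Pi.single_apply] using this
    · have := h (Pi.single (Sum.inl j) 1)
      rw [stdForm_apply] at this
      simpa [Pi.single_apply] using this

/-- Diagonal semisimilitudes. -/
def dg (τ : F ≃+* F) (ν : F) (hν : ν ≠ 0) : (n ⊕ n → F) ≃+ (n ⊕ n → F) where
  toFun x := Sum.elim (fun i => τ (x (Sum.inl i))) (fun i => ν * τ (x (Sum.inr i)))
  invFun x := Sum.elim (fun i => τ.symm (x (Sum.inl i))) (fun i => τ.symm (ν⁻¹ * x (Sum.inr i)))
  left_inv x := by ext (i | i) <;> simp [hν]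
  right_inv x := by ext (i | i) <;> simp [hν]
  map_add' x y := by ext (i | i) <;> simp [mul_add]

omit [Fintype n] [DecidableEq n] in
lemma dg_inl (τ : F ≃+* F) (ν : F) (hν : ν ≠ 0) (x : n ⊕ n → F) (i : n) :
    dg τ ν hν x (Sum.inl i) = τ (x (Sum.inl i)) := rfl
omit [Fintype n] [DecidableEq n] in
lemma dg_inr (τ : F ≃+* F) (ν : F) (hν : ν ≠ 0) (x : n ⊕ n → F) (i : n) :
    dg τ ν hν x (Sum.inr i) = ν * τ (x (Sum.inr i)) := rfl

omit [DecidableEq n] in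
lemma dg_SS (τ : F ≃+* F) (ν : F) (hν : ν ≠ 0) : SS (stdForm F n) (dg τ ν hν) τ ν where
  smul c x := by ext (i | i) <;> simp [dg_inl, dg_inr]; ring
  ne := hν
  form x y := by
    rw [stdForm_apply, stdForm_apply, map_sum, Finset.mul_sum]
    congr 1; ext i; simp only [dg_inl, dg_inr, map_sub, map_mul]; ring

/-- An antidiagonal similitude. -/
def ad (c : F) (hc : c ≠ 0) : (n ⊕ n → F) ≃+ (n ⊕ n → F) where
  toFun x := Sum.elim (fun i => -c * x (Sum.inr i)) (fun i => x (Sum.inl i))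
  invFun x := Sum.elim (fun i => x (Sum.inr i)) (fun i => -c⁻¹ * x (Sum.inl i))
  left_inv x := by ext (i | i) <;> simp [hc]
  right_inv x := by ext (i | i) <;> simp [hc]
  map_add' x y := by ext (i | i) <;> simp [mul_add, add_comm]

omit [Fintype n] [DecidableEq n] in
lemma ad_inl (c : F) (hc : c ≠ 0) (x : n ⊕ n → F) (i : n) :
    ad c hc x (Sum.inl i) = -c * x (Sum.inr i) := rfl
omit [Fintype n] [DecidableEq n] in
lemma ad_inr (c : F) (hc : c ≠ 0) (x : n ⊕ n → F) (i : n) :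
    ad c hc x (Sum.inr i) = x (Sum.inl i) := rfl

omit [DecidableEq n] in
lemma ad_SS (c : F) (hc : c ≠ 0) : SS (stdForm F n) (ad c hc) 1 c where
  smul k x := by ext (i | i) <;> simp [ad_inl, ad_inr]; ring
  ne := hc
  form x y := by
    rw [stdForm_apply, stdForm_apply, map_sum, Finset.mul_sum]
    congr 1; ext i; simp only [ad_inl, ad_inr, RingAut.one_apply]; ring

variable {G : Type*} [Group G] [Finite G] [Finite F] {π : Sp (stdForm F n) →* G}

omit [DecidableEq n] [Finite G] in
theorem supp_acts (C : Ctx π) (hall : ∀ g, ∃ A τ μ, Acts π g A τ μ) :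
    ∃ A : Subgroup G, (∀ x y : A, (x : G) * y = (y : G) * x) ∧ A ⊔ π.range = ⊤ := by
  obtain ⟨τ0, hτ0, hgen⟩ : ∃ τ0, τ0 ∈ autH π ∧ ∀ τ ∈ autH π, ∃ k : ℕ, τ = τ0 ^ k := by
    have : Finite (RingAut F) := Finite.of_injective (fun τ : RingAut F => (τ : F → F))
      fun a b h => RingEquiv.ext (congrFun h)
    obtain ⟨t, ht⟩ := IsCyclic.exists_generator (α := autH π)
    refine ⟨t, t.2, fun τ hτ => ?_⟩
    have h1 := ht ⟨τ, hτ⟩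
    rw [← mem_powers_iff_mem_zpowers] at h1
    obtain ⟨k, hk⟩ := h1
    exact ⟨k, by simpa using (congrArg Subtype.val hk).symm⟩
  obtain ⟨g0, A0, μ0, h0⟩ := hτ0
  by_cases hcase : ∃ d D c, Acts π d D 1 c ∧ ¬ IsSquare c
  · obtain ⟨d, D, c, hd, hc⟩ := hcase
    have hc0 := hd.ne
    obtain ⟨ν, hν, hτν⟩ := sq_of_nonsq (a := τ0 c) (b := c) (by
      rintro ⟨r, hr⟩
      exact hc ⟨τ0.symm r, by rw [← map_mul, ← hr]; simp⟩) hc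
    obtain ⟨s1, ha⟩ := hd.realize (B := ad c hc0) one_ne_zero (by
      simpa using ad_SS c hc0)
    obtain ⟨b, μb, hb⟩ : ∃ b μb, Acts π b (dg τ0 ν hν) τ0 μb := by
      by_cases h1 : IsSquare (ν / μ0)
      · obtain ⟨r, hr⟩ := h1
        have hr2 : ν = r ^ 2 * μ0 := by
          rw [div_eq_iff h0.ne] at hr; rw [hr]; ring
        obtain ⟨s, hs⟩ := h0.realize (r := r) (B := dg τ0 ν hν)
          (by rintro rfl; exact hν (by simpa using hr2)) (by rw [← hr2]; exact dg_SS τ0 ν hν)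
        exact ⟨_, _, hs⟩
      · obtain ⟨r, hr0, hr⟩ := sq_of_nonsq h1 hc
        have hr2 : ν = r ^ 2 * (c * μ0) := by
          rw [div_eq_iff h0.ne] at hr; rw [hr]; ring
        have h2 := hd.mul h0
        rw [one_mul, RingAut.one_apply] at h2
        obtain ⟨s, hs⟩ := h2.realize (r := r) (B := dg τ0 ν hν)
          hr0 (by rw [← hr2]; exact dg_SS τ0 ν hν)
        exact ⟨_, _, hs⟩
    set a := π s1 * d
    have hab : b * a = a * b := by
      apply (ha.mul hb).uniq C (hb.mul ha) hν
      intro x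
      ext (i | i)
      · simp only [AddEquiv.trans_apply, Pi.smul_apply, dg_inl, dg_inr, ad_inl, smul_eq_mul, map_mul,
          map_neg, hτν]
        ring
      · simp only [AddEquiv.trans_apply, Pi.smul_apply, dg_inr, ad_inr, smul_eq_mul, dg_inl]
    have hcomm := Subgroup.isMulCommutative_closure (k := {a, b}) (by
      intro x hx y hy
      rcases hx with rfl | rfl <;> rcases hy with rfl | rfl <;> simp [hab])
    refine ⟨Subgroup.closure {a, b}, ?_, ?_⟩
    · intro x y
      have := hcomm.is_comm.comm x y
      simpa using congrArg Subtype.val this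
    · rw [eq_top_iff]
      intro g _
      have haA : a ∈ Subgroup.closure {a, b} := Subgroup.subset_closure (by simp)
      have hbA : b ∈ Subgroup.closure {a, b} := Subgroup.subset_closure (by simp)
      have key : ∀ h ∈ Subgroup.closure {a, b}, (∃ s, g = π s * h) →
          g ∈ Subgroup.closure {a, b} ⊔ π.range := by
        rintro h hh ⟨s, rfl⟩
        exact mul_mem (le_sup_right (a := Subgroup.closure {a, b}) ⟨s, rfl⟩)
          (le_sup_left (b := π.range) hh)
      obtain ⟨A, τ, μ, hg⟩ := hall g
      obtain ⟨k, rfl⟩ := hgen τ ⟨_, _, _, hg⟩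
      obtain ⟨A', μ', hbk⟩ := hb.pow k
      by_cases h1 : IsSquare (μ / μ')
      · obtain ⟨r, hr⟩ := h1
        rw [div_eq_iff hbk.ne] at hr
        exact key (b ^ k) (pow_mem hbA k) (hg.coset C hbk (r := r) (by rw [hr]; ring))
      · obtain ⟨r, hr0, hr⟩ := sq_of_nonsq h1 hc
        rw [div_eq_iff hbk.ne] at hr
        have h2 := ha.mul hbk
        rw [one_mul, RingAut.one_apply] at h2
        exact key (a * b ^ k) (mul_mem haA (pow_mem hbA k))
          (hg.coset C h2 (r := r) (by rw [hr]; ring))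
  · push Not at hcase
    refine ⟨Subgroup.zpowers g0, ?_, ?_⟩
    · rintro ⟨x, i, rfl⟩ ⟨y, j, rfl⟩
      simp only [← zpow_add, add_comm]
    · rw [eq_top_iff]
      intro g _
      obtain ⟨A, τ, μ, hg⟩ := hall g
      obtain ⟨k, rfl⟩ := hgen τ ⟨_, _, _, hg⟩
      obtain ⟨A', μ', hbk⟩ := h0.pow k
      have h1 := hg.mul hbk.inv
      rw [mul_inv_cancel] at h1
      obtain ⟨r, hr⟩ := hcase _ _ _ h1
      obtain ⟨s, hs⟩ := h1.mem_range C (r := r) (by rw [hr]; ring)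
      have h2 : g = π s * g0 ^ k := by rw [← hs]; group
      rw [h2]
      exact mul_mem (le_sup_right (a := Subgroup.zpowers g0) ⟨s, rfl⟩)
          (le_sup_left (b := π.range) (pow_mem (Subgroup.mem_zpowers g0) k))

end std
end AbSp


namespace AbSp
open Submodule

section stepB
variable {F V : Type*} [Field F] [AddCommGroup V] [Module F V]
variable {ω : LinearMap.BilinForm F V} (hω : Form ω)
variable {G : Type*} [Group G] {π : Sp ω →* G}

lemma Form.symm2 (hω : Form ω) [CharP F 2] (x y : V) : ω x y = ω y x := by
  rw [hω.swap y x, CharTwo.neg_eq]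

lemma Ctx.inj2 (hω : Form ω) [CharP F 2] (C : Ctx π) : Function.Injective π := by
  rw [injective_iff_map_eq_one]
  intro s hs
  obtain ⟨c, hc⟩ := (C.ker s).1 hs
  by_cases hV : ∃ x : V, x ≠ 0
  · obtain ⟨x, hx⟩ := hV
    obtain ⟨y, hy⟩ := hω.exists_pair hx
    have h1 := Sp.iso s y x
    rw [hc, hc] at h1
    simp only [map_smul, LinearMap.smul_apply, hy, smul_eq_mul, mul_one] at h1
    have h2 : (c - 1) * (c - 1) = 0 := by
      linear_combination h1 + (1 - c) * CharTwo.two_eq_zero (R := F)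
    have h3 : c = 1 := by
      rw [mul_self_eq_zero, sub_eq_zero] at h2; exact h2
    apply Sp.ext
    intro x
    rw [hc, h3, one_smul]; rfl
  · push Not at hV
    apply Sp.ext
    intro x
    rw [hV x, map_zero, map_zero]

/-- A commutation property of long root elements. -/
def PP (π : Sp ω →* G) (x : G) : Prop :=
  ∀ s, ∀ x', x' = π s * x * (π s)⁻¹ → (x' * x * x'⁻¹) * x = x * (x' * x * x'⁻¹) → x' * x = x * x'

lemma PP.conj (C : Ctx π) {x : G} (h : PP π x) (g : G) : PP π (g * x * g⁻¹) := by
  rintro s x' hx' hc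
  obtain ⟨s', hs'⟩ : ∃ s', π s' = g⁻¹ * π s * g := by
    simpa using C.normal.conj_mem _ ⟨s, rfl⟩ g⁻¹
  have h1 := h s' (g⁻¹ * x' * g) (by rw [hs', hx']; group) (by
    calc _ = g⁻¹ * (x' * (g * x * g⁻¹) * x'⁻¹ * (g * x * g⁻¹)) * g := by group
      _ = _ := by rw [hc]; group)
  calc _ = g * (g⁻¹ * x' * g * x) * g⁻¹ := by group
    _ = _ := by rw [h1]; group

lemma PP.T [FiniteDimensional F V] (hd : Dim3 F V) (C : Ctx π) (v : V) (a : F) :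
    PP π (π (T hω v a)) := by
  by_cases ha : a = 0
  · subst ha
    intro s x' hx' _
    rw [T_zero]; simp
  by_cases hv : v = 0
  · have h0 : AbSp.T hω v a = 1 := Sp.ext fun x => by simp [T_apply, hv]
    intro s x' hx' _
    rw [h0]; simp
  intro s x' hx' hc
  rw [← map_inv, ← map_mul, ← map_mul, T_conj] at hx'
  subst hx'
  set u := s.1 v
  rw [← mul_inv_eq_iff_eq_mul, T_comm_iff hω hd C hv ha ha]
  rw [← map_inv, ← map_mul, ← map_mul, T_conj, ← mul_inv_eq_iff_eq_mul,
    T_comm_iff hω hd C (by simpa using hv) ha ha, T_apply] at hc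
  simp only [map_add, map_smul, hω.alt, smul_eq_mul, LinearMap.add_apply, LinearMap.smul_apply,
    zero_add, mul_eq_zero, ha, false_or] at hc
  rcases hc with h | h <;> exact h

variable [FiniteDimensional F V]

lemma wstar (hω : Form ω) {v w : V} (hw : w ∉ span F {v}) : ∃ x, ω v x = 0 ∧ ω w x = 1 := by
  obtain ⟨z, hz, hz2⟩ := perp_sep hω _ hw
  refine ⟨(ω w z)⁻¹ • z, ?_, ?_⟩
  · rw [map_smul, hz v (mem_span_singleton_self v), smul_zero]
  · rw [map_smul, smul_eq_mul, inv_mul_cancel₀ hz2]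

lemma PP.elim [CharP F 2] (C : Ctx π) {v w : V} (hv : v ≠ 0) {h : ω v w = 0} {c : F}
    (hP : PP π (π (E hω v w h c))) {s : Sp ω} {r : V} (hsv : (s * E hω v w h c * s⁻¹).1 v = v)
    (hsw : (s * E hω v w h c * s⁻¹).1 w = w + r) : r ∈ span F {v} := by
  set z := E hω v w h c with hz
  set z' := s * z * s⁻¹ with hz'
  have h0 : ω v (w + r) = 0 := by
    rw [← hsw]; conv_lhs => rw [← hsv]
    rw [Sp.iso, h]
  have h1 : z' * z * z'⁻¹ = E hω v (w + r) h0 c := by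
    rw [hz, E_conj]
    exact E_congr hω _ _ hsv hsw rfl
  have h2 := hP s (π z') (by rw [hz']; simp) (by
    rw [← map_inv, ← map_mul, ← map_mul, ← map_mul, ← map_mul, h1, hz]
    congr 1
    rw [E_mul, E_mul]
    exact E_congr hω _ _ rfl (by abel) (by rw [hω.symm2]))
  rw [← map_mul, ← map_mul] at h2
  have h3 := C.inj2 hω h2
  rw [← mul_inv_eq_iff_eq_mul, h1, hz] at h3
  obtain ⟨k, hk, -⟩ := E_eq hω hv _ _ h3
  rw [mem_span_singleton]
  refine ⟨-k, ?_⟩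
  rw [neg_smul]
  linear_combination (norm := module) hk

lemma PP.c_zero [CharP F 2] (C : Ctx π) {v w : V} (hv : v ≠ 0) (h : ω v w = 0) {c : F}
    (hw : w ∉ span F {v}) (hP : PP π (π (E hω v w h c))) : c = 0 := by
  by_contra hc
  obtain ⟨x, hvx, hwx⟩ := wstar hω hw
  have hx0 : x ≠ 0 := by rintro rfl; simp at hwx
  have hvx' : v ∉ span F {x} := by
    intro hcon
    obtain ⟨k, hk⟩ := mem_span_singleton.1 hcon
    have h1 := hω.swap0 h
    rw [← hk, map_smul, hwx, smul_eq_mul, mul_one] at h1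
    rw [h1, zero_smul] at hk
    exact hv hk.symm
  obtain ⟨s, hs1, hs2⟩ := trans2 hω hv hx0 hw hvx' (by rw [h, hω.swap0 hvx])
  have hz : s * E hω v w h c * s⁻¹ = E hω x v (hω.swap0 hvx) c := by
    rw [E_conj]; exact E_congr hω _ _ hs1 hs2 rfl
  have h1 := hP.elim hω C hv (s := s) (r := c • x + v)
    (by rw [hz, E_apply, hvx, hω.alt]; simp)
    (by rw [hz, E_apply, hwx, hω.swap0 h]; simp [add_assoc])
  obtain ⟨k, hk⟩ := mem_span_singleton.1 h1
  have h2 := congrArg (ω w) hk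
  simp only [map_smul, map_add, hω.swap0 h, hwx] at h2
  apply hc
  simpa using h2.symm

lemma PP.false6 [CharP F 2] (hd : ∀ a b c d : V, ∃ z, z ∉ span F {a, b, c, d})
    (C : Ctx π) {v w : V} (hv : v ≠ 0) (h : ω v w = 0) {c : F}
    (hw : w ∉ span F {v}) (hP : PP π (π (E hω v w h c))) : False := by
  obtain ⟨x, hvx, hwx⟩ := wstar hω hw
  obtain ⟨y, hy⟩ := hω.exists_pair hv
  obtain ⟨z, hz⟩ := hd v w x y
  obtain ⟨u, hu, hzu⟩ := perp_sep hω _ hz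
  have hvu := hu v (subset_span (by simp))
  have hwu := hu w (subset_span (by simp))
  have hxu := hu x (subset_span (by simp))
  have hyu := hu y (subset_span (by simp))
  have hu0 : u ≠ 0 := by rintro rfl; simp at hzu
  have hxu' : x ∉ span F {u} := by
    intro hcon
    obtain ⟨k, hk⟩ := mem_span_singleton.1 hcon
    rw [← hk, map_smul, hwu] at hwx
    simp at hwx
  obtain ⟨s, hs1, hs2⟩ := trans2 hω hv hu0 hw hxu' (by rw [h, hω.swap0 hxu])
  have hz : s * E hω v w h c * s⁻¹ = E hω u x (hω.swap0 hxu) c := by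
    rw [E_conj]; exact E_congr hω _ _ hs1 hs2 rfl
  have h1 := hP.elim hω C hv (s := s) (r := u)
    (by rw [hz, E_apply, hvx, hvu]; simp)
    (by rw [hz, E_apply, hwx, hwu]; simp)
  obtain ⟨k, hk⟩ := mem_span_singleton.1 h1
  rw [← hk, map_smul, hy, smul_eq_mul, mul_one] at hyu
  rw [hyu, zero_smul] at hk
  exact hu0 hk.symm

lemma dim3_of_finrank (h : 3 ≤ Module.finrank F V) : Dim3 F V := by
  classical
  intro a b
  by_contra hcon
  push Not at hcon
  have h1 : span F ((({a, b} : Finset V) : Set V)) = ⊤ := by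
    rw [eq_top_iff]; intro x _; simpa using hcon x
  have h2 := finrank_span_finset_le_card (R := F) ({a, b} : Finset V)
  have h3 := Finset.card_le_two (a := a) (b := b)
  rw [Set.finrank, h1, finrank_top] at h2
  omega

lemma dim5_of_finrank (h : 5 ≤ Module.finrank F V) (a b c d : V) :
    ∃ z, z ∉ span F {a, b, c, d} := by
  classical
  by_contra hcon
  push Not at hcon
  have h1 : span F ((({a, b, c, d} : Finset V) : Set V)) = ⊤ := by
    rw [eq_top_iff]; intro x _; simpa using hcon x
  have h2 := finrank_span_finset_le_card (R := F) ({a, b, c, d} : Finset V)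
  have h3 := Finset.card_le_four (a := a) (b := b) (c := c) (d := d)
  rw [Set.finrank, h1, finrank_top] at h2
  omega

lemma iso_four (hω : Form ω) (h4 : Module.finrank F V = 4) {v w x : V} (hv : v ≠ 0)
    (hw : w ∉ span F {v}) (hvw : ω v w = 0) (hvx : ω v x = 0) (hwx : ω w x = 0) :
    x ∈ span F {v, w} := by
  have h1 : span F {v, w} ≤ ω.orthogonal (span F {v, w}) := by
    intro y hy
    rw [LinearMap.BilinForm.mem_orthogonal_iff]
    intro z hz
    obtain ⟨a, b, rfl⟩ := mem_span_pair.1 hy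
    obtain ⟨a', b', rfl⟩ := mem_span_pair.1 hz
    change ω _ _ = 0
    simp [hω.alt, hvw, hω.swap0 hvw]
  have h2 : Module.finrank F (span F {v, w}) = 2 := by
    have hli : LinearIndependent F ![v, w] := by
      rw [LinearIndependent.pair_iff' hv]
      intro a ha
      exact hw (mem_span_singleton.2 ⟨a, ha⟩)
    have := finrank_span_eq_card hli
    have hr : Set.range ![v, w] = {v, w} := by
      ext y; simp [eq_comm, or_comm]
    rw [hr] at this
    simpa using this
  have h3 := LinearMap.BilinForm.finrank_orthogonal hω.nondeg (span F {v, w})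
  rw [eq_of_le_of_finrank_eq h1 (by omega), LinearMap.BilinForm.mem_orthogonal_iff]
  intro z hz
  obtain ⟨a', b', rfl⟩ := mem_span_pair.1 hz
  change ω _ _ = 0
  simp [hvx, hwx]

/-- Elements swapping long and short root groups. -/
def SW (hω : Form ω) (π : Sp ω →* G) (g : G) : Prop :=
  ∀ v, v ≠ 0 → ∃ v' w', ∃ h : ∀ b : F, ω v' (b • w') = 0, v' ≠ 0 ∧ w' ∉ span F {v'} ∧
    ∀ a, ∃ b, g * π (T hω v a) * g⁻¹ = π (E hω v' (b • w') (h b) 0)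

lemma E_add_smul [CharP F 2] {v w : V} {k : F} (h : ω v w = 0) (h' : ω v (k • v + w) = 0) :
    E hω v (k • v + w) h' 0 = E hω v w h 0 := by
  apply Sp.ext
  intro x
  simp only [E_apply, map_add, map_smul, smul_eq_mul]
  have h2 : (2 * (k * ω x v)) • v = 0 := by rw [CharTwo.two_eq_zero, zero_mul, zero_smul]
  linear_combination (norm := module) h2

theorem type_cases [CharP F 2] [Finite V] [Finite G] (C : Ctx π)
    (hN : Module.finrank F V = 4 ∨ 6 ≤ Module.finrank F V) (g : G) :
    TP hω π g ∨ (Module.finrank F V = 4 ∧ SW hω π g) := by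
  have hd : Dim3 F V := dim3_of_finrank (by omega)
  have : Nontrivial V := Module.nontrivial_of_finrank_pos (R := F) (by omega)
  have : Fact (Nat.Prime 2) := ⟨Nat.prime_two⟩
  obtain ⟨v0, hv0⟩ := exists_ne (0 : V)
  obtain ⟨v', hv', hst⟩ := stepA hω C 2 g hv0
  choose w hw c hE _ using hst
  have hP : ∀ a, PP π (π (E hω v' (w a) (hw a) (c a))) := fun a => by
    rw [← hE]; exact (PP.T hω hd C v0 a).conj C g
  have move : ∀ v, v ≠ 0 → ∃ s s' : Sp ω, s.1 v0 = v ∧ ∀ a x,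
      g * π (T hω v0 a) * g⁻¹ = π x → g * π (T hω v a) * g⁻¹ = π (s' * x * s'⁻¹) := by
    intro v hv
    obtain ⟨s, hs⟩ := trans1 hω hv0 hv
    obtain ⟨s', hs'⟩ : ∃ s', π s' = g * π s * g⁻¹ := C.normal.conj_mem _ ⟨s, rfl⟩ g
    refine ⟨s, s', hs, fun a x hx => ?_⟩
    rw [← hs, ← T_conj]
    simp only [map_mul, map_inv]
    rw [hs', ← hx]; group
  by_cases hall : ∀ a, w a ∈ span F {v'}
  · left
    intro v hv
    obtain ⟨s, s', hs, hmv⟩ := move v hv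
    refine ⟨s'.1 v', by simpa using hv', fun a => ?_⟩
    obtain ⟨k, hk⟩ := mem_span_singleton.1 (hall a)
    refine ⟨c a + 2 * k, ?_⟩
    rw [hmv a _ (hE a), ← T_conj, ← E_eq_T hω k (c a) (by rw [hk]; exact hw a)]
    congr 3
    exact E_congr hω _ _ rfl hk.symm rfl
  · right
    push Not at hall
    obtain ⟨a1, ha1⟩ := hall
    have h4 : Module.finrank F V = 4 := by
      rcases hN with h | h
      · exact h
      · exact ((hP a1).false6 hω (dim5_of_finrank (by omega)) C hv' _ ha1).elim
    refine ⟨h4, ?_⟩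
    have hc1 := (hP a1).c_zero hω C hv' _ ha1
    have hmulE : ∀ a, PP π (π (E hω v' (w a + w a1) (by rw [map_add, hw, hw, add_zero])
        (c a + ω (w a1) (w a)))) := by
      intro a
      have h1 : π (E hω v' (w a + w a1) (by rw [map_add, hw, hw, add_zero])
        (c a + ω (w a1) (w a))) = g * π (T hω v0 (a + a1)) * g⁻¹ := by
        rw [← T_mul, map_mul]
        have : E hω v' (w a + w a1) (by rw [map_add, hw, hw, add_zero])
          (c a + ω (w a1) (w a)) = E hω v' (w a) (hw a) (c a) * E hω v' (w a1) (hw a1) (c a1) := by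
          rw [E_mul]
          exact E_congr hω _ _ rfl rfl (by rw [hc1]; ring)
        rw [this, map_mul, ← hE, ← hE]; group
      rw [h1]
      exact (PP.T hω hd C v0 (a + a1)).conj C g
    have h0 : ∀ b : F, ω v' (b • w a1) = 0 := fun b => by rw [map_smul, hw, smul_zero]
    have key : ∀ a, ∃ b, E hω v' (w a) (hw a) (c a) = E hω v' (b • w a1) (h0 b) 0 := by
      intro a
      by_cases ha : w a ∈ span F {v'}
      · obtain ⟨k, hk⟩ := mem_span_singleton.1 ha
        have h3 := (hmulE a).c_zero hω C hv' _ (by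
          intro hcon
          have := sub_mem hcon ha
          simp only [add_sub_cancel_left] at this
          exact ha1 this)
        rw [← hk] at h3
        simp only [map_smul, hω.swap0 (hw a1), smul_zero, add_zero] at h3
        refine ⟨0, ?_⟩
        rw [E_congr hω _ (show ω v' (k • v' + (0 : F) • w a1) = 0 by simp [hω.alt]) rfl
          (show w a = k • v' + (0 : F) • w a1 by simp [hk]) h3]
        exact E_add_smul hω _ _
      · have hca := (hP a).c_zero hω C hv' _ ha
        have h3 : ω (w a1) (w a) = 0 := by
          by_cases h5 : w a + w a1 ∈ span F {v'}
          · obtain ⟨k, hk⟩ := mem_span_singleton.1 h5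
            have h6 : w a = k • v' - w a1 := by rw [hk]; abel
            rw [h6, map_sub, map_smul, hω.swap0 (hw a1), hω.alt]; simp
          · have := (hmulE a).c_zero hω C hv' _ h5
            simpa [hca] using this
        obtain ⟨k, b, hkb⟩ := mem_span_pair.1 (iso_four hω h4 hv' ha1 (hw a1) (hw a) h3)
        refine ⟨b, ?_⟩
        rw [E_congr hω _ (show ω v' (k • v' + b • w a1) = 0 by simp [hω.alt, hw]) rfl
          hkb.symm hca]
        exact E_add_smul hω _ _
    intro v hv
    obtain ⟨s, s', hs, hmv⟩ := move v hv
    refine ⟨s'.1 v', s'.1 (w a1), fun b => ?_, by simpa using hv', ?_, fun a => ?_⟩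
    · rw [map_smul, Sp.iso, hw, smul_zero]
    · intro hcon
      obtain ⟨k, hk⟩ := mem_span_singleton.1 hcon
      rw [← map_smul] at hk
      exact ha1 (mem_span_singleton.2 ⟨k, s'.1.injective hk⟩)
    · obtain ⟨b, hb⟩ := key a
      refine ⟨b, ?_⟩
      rw [hmv a _ (hE a), hb, E_conj]
      congr 1
      exact E_congr hω _ _ rfl (map_smul _ _ _) rfl

theorem TP_odd [Finite F] [Finite V] [Finite G] (C : Ctx π) (h2 : (2 : F) ≠ 0) [Nontrivial V]
    (g : G) : TP hω π g := by
  obtain ⟨p, hp⟩ := CharP.exists F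
  have : Fact p.Prime := ⟨CharP.char_is_prime F p⟩
  intro v hv
  obtain ⟨v', hv', h⟩ := stepA hω C p g hv
  refine ⟨v', hv', fun a => ?_⟩
  obtain ⟨w, hw, c, hE, hw0⟩ := h a
  refine ⟨c, ?_⟩
  rw [hE]
  congr 1
  exact E_congr hω _ _ rfl (hw0 h2) rfl

end stepB
end AbSp


namespace AbSp
open Submodule

section dim4
variable {F V : Type*} [Field F] [AddCommGroup V] [Module F V]
variable {ω : LinearMap.BilinForm F V} (hω : Form ω)
variable {G : Type*} [Group G] {π : Sp ω →* G}

/-- Short root elements. -/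
def Y (v w : V) (h : ω v w = 0) (a : F) : Sp ω := E hω v (a • w) (by rw [map_smul, h, smul_zero]) 0

lemma Y_apply {v w : V} (h : ω v w = 0) (a : F) (x : V) :
    (Y hω v w h a).1 x = x + (a * ω x w) • v + (a * ω x v) • w := by
  rw [Y, E_apply]
  simp only [map_smul, smul_eq_mul, zero_mul, zero_add]
  module

lemma Y_mul {v w : V} (h : ω v w = 0) (a b : F) :
    Y hω v w h a * Y hω v w h b = Y hω v w h (a + b) := by
  unfold Y
  rw [E_mul]
  exact E_congr hω _ _ rfl (by module) (by simp [hω.alt])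

lemma Y_conj {v w : V} (h : ω v w = 0) (a : F) (s : Sp ω) {v' w' : V} (hv : s.1 v = v')
    (hw : s.1 w = w') (h' : ω v' w' = 0) : s * Y hω v w h a * s⁻¹ = Y hω v' w' h' a := by
  unfold Y
  rw [E_conj]
  exact E_congr hω _ _ hv (by rw [map_smul, hw]) rfl

lemma Y_inj {v w : V} (h : ω v w = 0) (hv : v ≠ 0) (hw : w ∉ span F {v}) {a b : F}
    (hab : Y hω v w h a = Y hω v w h b) : a = b := by
  obtain ⟨k, hk, -⟩ := E_eq hω hv _ _ hab
  by_contra hne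
  apply hw
  rw [mem_span_singleton]
  have hne' : b - a ≠ 0 := sub_ne_zero.2 (Ne.symm hne)
  refine ⟨(b - a)⁻¹ * k, ?_⟩
  rw [mul_smul, inv_smul_eq_iff₀ hne']
  linear_combination (norm := module) -hk

lemma Y_zero {v w : V} (h : ω v w = 0) : Y hω v w h 0 = 1 := by
  apply Sp.ext; intro x; simp [Y_apply]

lemma Y_span [CharP F 2] {v u p q : V} (h : ω v u = 0) (h' : ω p q = 0) (hp : p ∈ span F {v, u})
    (hq : q ∈ span F {v, u}) (b : F) : ∃ b', Y hω p q h' b = Y hω v u h b' := by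
  obtain ⟨α, β, rfl⟩ := mem_span_pair.1 hp
  obtain ⟨γ, δ, rfl⟩ := mem_span_pair.1 hq
  refine ⟨b * (α * δ + β * γ), ?_⟩
  apply Sp.ext
  intro x
  simp only [Y_apply, map_add, map_smul, smul_eq_mul]
  have h1 : ∀ (c : F) (y : V), (2 * c) • y = 0 := fun c y => by
    rw [CharTwo.two_eq_zero, zero_mul, zero_smul]
  linear_combination (norm := module) h1 (b * α * γ * ω x v) v + h1 (b * β * δ * ω x u) u

variable [FiniteDimensional F V]

lemma TY_comm (hd : Dim3 F V) (C : Ctx π) {v p q : V} (hp : p ≠ 0) (hq : q ∉ span F {p})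
    (h : ω p q = 0) {b c : F} (hb : b ≠ 0) (hc : c ≠ 0) :
    Commute (π (Y hω p q h b)) (π (T hω v c)) ↔ ω v p = 0 ∧ ω v q = 0 := by
  rw [commute_iff_eq, ← mul_inv_eq_iff_eq_mul, ← map_inv, ← map_mul, ← map_mul, T_conj]
  constructor
  · intro h1
    obtain ⟨k, hk⟩ := mem_span_singleton.1 (T_same hω hd C hc h1)
    rw [Y_apply] at hk
    have h2 := congrArg (fun y => ω y p) hk
    have h3 := congrArg (fun y => ω y q) hk
    simp only [map_add, map_smul, LinearMap.add_apply, LinearMap.smul_apply, hω.alt, h, hω.swap0 h,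
      smul_eq_mul, mul_zero, add_zero] at h2 h3
    by_cases hk1 : k = 1
    · have h4 : (b * ω v q) • p + (b * ω v p) • q = 0 := by
        rw [hk1, one_smul] at hk
        linear_combination (norm := module) -hk
      have h5 : ω v p = 0 := by
        by_contra hne
        apply hq
        rw [mem_span_singleton]
        refine ⟨-((b * ω v p)⁻¹ * (b * ω v q)), ?_⟩
        rw [neg_smul, mul_smul, ← smul_neg, inv_smul_eq_iff₀ (mul_ne_zero hb hne)]
        linear_combination (norm := module) -h4
      rw [h5] at h4
      simp [hb, hp] at h4
      exact ⟨h5, h4⟩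
    · have hk2 : k - 1 ≠ 0 := sub_ne_zero.2 hk1
      constructor
      · exact (mul_eq_zero.1 (show (k - 1) * ω v p = 0 by linear_combination h2)).resolve_left hk2
      · exact (mul_eq_zero.1 (show (k - 1) * ω v q = 0 by linear_combination h3)).resolve_left hk2
  · rintro ⟨h1, h2⟩
    rw [Y_apply, h1, h2]
    simp

variable [CharP F 2] [Finite F] [Finite V] [Finite G]

lemma not_TP_inv {g : G} (hg : ¬ TP hω π g) : ¬ TP hω π g⁻¹ :=
  fun h => hg (by simpa using h.inv hω)

lemma SW_of (C : Ctx π) (h4 : Module.finrank F V = 4) {g : G} (hg : ¬ TP hω π g) {v : V}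
    (hv : v ≠ 0) : ∃ v' w', ∃ h : ω v' w' = 0, v' ≠ 0 ∧ w' ∉ span F {v'} ∧
    ∀ a, ∃ b, g * π (T hω v a) * g⁻¹ = π (Y hω v' w' h b) := by
  obtain ⟨v', w', h, h1, h2, h3⟩ := ((type_cases hω C (Or.inl h4) g).resolve_left hg).2 v hv
  exact ⟨v', w', by simpa using h 1, h1, h2, h3⟩

lemma SW_short (C : Ctx π) (h4 : Module.finrank F V = 4) {g : G} (hg : ¬ TP hω π g) {v w : V}
    (hv : v ≠ 0) (hw : w ∉ span F {v}) (h : ω v w = 0) :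
    ∃ u, u ≠ 0 ∧ ∀ a, ∃ c, g * π (Y hω v w h a) * g⁻¹ = π (T hω u c) := by
  obtain ⟨v', w', h', hv', hw', hβ⟩ := SW_of hω C h4 (not_TP_inv hω hg) hv
  choose β hβ using hβ
  have hinj : Function.Injective β := by
    intro a b hab
    have h1 := hβ a
    rw [hab, ← hβ] at h1
    simp only [mul_left_inj, mul_right_inj] at h1
    exact T_inj_right hω hv (C.inj2 hω h1)
  have hsurj := Finite.surjective_of_injective hinj
  obtain ⟨s, hs1, hs2⟩ := trans2 hω hv' hv hw' hw (by rw [h, h'])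
  obtain ⟨s', hs'⟩ : ∃ s', π s' = g * π s * g⁻¹ := C.normal.conj_mem _ ⟨s, rfl⟩ g
  refine ⟨s'.1 v, by simpa using hv, fun a => ?_⟩
  obtain ⟨c, rfl⟩ := hsurj a
  refine ⟨c, ?_⟩
  rw [← T_conj, ← Y_conj hω h' _ s hs1 hs2 h]
  simp only [map_mul, map_inv]
  rw [← hβ, hs']; group

lemma TP_of_two (C : Ctx π) (h4 : Module.finrank F V = 4) {g h : G} (hg : ¬ TP hω π g)
    (hh : ¬ TP hω π h) : TP hω π (g * h) := by
  intro v hv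
  obtain ⟨v', w', h', hv', hw', hβ⟩ := SW_of hω C h4 hh hv
  obtain ⟨u, hu, h1⟩ := SW_short hω C h4 hg hv' hw' h'
  refine ⟨u, hu, fun a => ?_⟩
  obtain ⟨b, hb⟩ := hβ a
  obtain ⟨c, hc⟩ := h1 b
  refine ⟨c, ?_⟩
  rw [← hc, ← hb]; group

/-- A partial symplectic basis. -/
structure SB (ω : LinearMap.BilinForm F V) (e₁ e₂ f₂ : V) : Prop where
  ne : e₁ ≠ 0
  h12 : ω e₁ e₂ = 0
  h1f : ω e₁ f₂ = 0
  h2f : ω e₂ f₂ = 1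
  n2 : e₂ ∉ span F {e₁}
  nf : f₂ ∉ span F {e₁}

lemma SB.of (hω : Form ω) {e₁ e₂ f₂ : V} (ne : e₁ ≠ 0) (h12 : ω e₁ e₂ = 0) (h1f : ω e₁ f₂ = 0)
    (h2f : ω e₂ f₂ = 1) : SB ω e₁ e₂ f₂ := by
  refine ⟨ne, h12, h1f, h2f, ?_, ?_⟩
  · intro h
    obtain ⟨k, rfl⟩ := mem_span_singleton.1 h
    simp [h1f] at h2f
  · intro h
    obtain ⟨k, rfl⟩ := mem_span_singleton.1 h
    simp [hω.swap0 h12] at h2f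

lemma SB.ne2 {e₁ e₂ f₂ : V} (h : SB ω e₁ e₂ f₂) : e₂ ≠ 0 := by
  rintro rfl; exact h.n2 (zero_mem _)

lemma SB.trans (hω : Form ω) {e₁ e₂ f₂ v u w : V} (h : SB ω e₁ e₂ f₂) (h' : SB ω v u w) :
    ∃ s : Sp ω, s.1 v = e₁ ∧ s.1 u = e₂ ∧ s.1 w = f₂ := by
  obtain ⟨s, hs1, hs2⟩ := trans2 hω h'.ne h.ne h'.n2 h.n2 (by rw [h.h12, h'.h12])
  have ho1 : ω e₁ (s.1 w) = 0 := by rw [← hs1, Sp.iso, h'.h1f]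
  have ho2 : ω e₂ (s.1 w) = 1 := by rw [← hs2, Sp.iso, h'.h2f]
  have hn : ∀ x, ω e₂ x = 1 → x ∉ span F {e₁, e₂} := by
    intro x hx hc
    obtain ⟨a, b, rfl⟩ := mem_span_pair.1 hc
    simp [hω.alt, hω.swap0 h.h12] at hx
  obtain ⟨t, ht, ht2⟩ := witt_step hω (R := span F {e₁, e₂}) (w := s.1 w) (w' := f₂) (by
    intro r hr
    obtain ⟨a, b, rfl⟩ := mem_span_pair.1 hr
    simp [ho1, ho2, h.h1f, h.h2f]) (hn _ ho2) (hn _ h.h2f)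
  refine ⟨t * s, ?_, ?_, ?_⟩
  · rw [Sp.mul_app, hs1, ht _ (subset_span (by simp))]
  · rw [Sp.mul_app, hs2, ht _ (subset_span (by simp))]
  · rw [Sp.mul_app, ht2]

lemma normalise (C : Ctx π) (h4 : Module.finrank F V = 4) {g : G} (hg : ¬ TP hω π g)
    {e₁ e₂ f₂ : V} (hb : SB ω e₁ e₂ f₂) : ∃ s : Sp ω, ∃ d, d = π s * g ∧
    (∀ b, ∃ c, d * π (T hω e₂ b) * d⁻¹ = π (Y hω e₁ f₂ hb.h1f c)) ∧
    (∀ b, ∃ c, d * π (Y hω e₁ f₂ hb.h1f b) * d⁻¹ = π (T hω e₂ c)) ∧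
    (∀ b, ∃ c, d * π (Y hω e₁ e₂ hb.h12 b) * d⁻¹ = π (T hω e₁ c)) ∧
    (∀ b, ∃ c, d * π (T hω e₁ b) * d⁻¹ = π (Y hω e₁ e₂ hb.h12 c)) := by
  have hd : Dim3 F V := dim3_of_finrank (by omega)
  obtain ⟨p, q, hpq, hp, hq, hβ⟩ := SW_of hω C h4 hg hb.ne
  obtain ⟨p', q', hpq', hp', hq', hβ'⟩ := SW_of hω C h4 hg hb.ne2
  obtain ⟨v, hv, hγ⟩ := SW_short hω C h4 hg hb.ne hb.n2 hb.h12
  obtain ⟨u, hu, hγ'⟩ := SW_short hω C h4 hg hb.ne hb.nf hb.h1f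
  choose β hβ using hβ
  choose β' hβ' using hβ'
  choose γ hγ using hγ
  choose γ' hγ' using hγ'
  have inj := C.inj2 hω
  have nt : ∀ x y : Sp ω, g * π x * g⁻¹ = π y → y = 1 → x = 1 := by
    intro x y h1 h2
    rw [h2, map_one, mul_inv_eq_one, mul_eq_left, ← map_one π] at h1
    exact inj h1
  have hT1 : ∀ x : V, x ≠ 0 → T hω x 1 ≠ 1 := by
    intro x hx h1
    rw [← T_zero hω x] at h1
    exact one_ne_zero (T_inj_right hω hx h1)
  have hY1 : ∀ x y (h : ω x y = 0), x ≠ 0 → y ∉ span F {x} → Y hω x y h 1 ≠ 1 := by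
    intro x y h hx hy h1
    rw [← Y_zero hω h] at h1
    exact one_ne_zero (Y_inj hω h hx hy h1)
  have nβ : β 1 ≠ 0 := fun h => hT1 _ hb.ne (nt _ _ (hβ 1) (by rw [h, Y_zero]))
  have nβ' : β' 1 ≠ 0 := fun h => hT1 _ hb.ne2 (nt _ _ (hβ' 1) (by rw [h, Y_zero]))
  have nγ : γ 1 ≠ 0 := fun h => hY1 _ _ _ hb.ne hb.n2 (nt _ _ (hγ 1) (by rw [h, T_zero]))
  have nγ' : γ' 1 ≠ 0 := fun h => hY1 _ _ _ hb.ne hb.nf (nt _ _ (hγ' 1) (by rw [h, T_zero]))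
  have c1 : ω v p = 0 ∧ ω v q = 0 := by
    rw [← TY_comm hω hd C hp hq hpq nβ nγ, ← hβ, ← hγ, Commute.conj_iff]
    exact ((TY_comm hω hd C hb.ne hb.n2 hb.h12 one_ne_zero one_ne_zero).2
      ⟨hω.alt _, hb.h12⟩).symm
  have c2 : ω v p' = 0 ∧ ω v q' = 0 := by
    rw [← TY_comm hω hd C hp' hq' hpq' nβ' nγ, ← hβ', ← hγ, Commute.conj_iff]
    exact ((TY_comm hω hd C hb.ne hb.n2 hb.h12 one_ne_zero one_ne_zero).2
      ⟨hω.swap0 hb.h12, hω.alt _⟩).symm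
  have c3 : ω u p = 0 ∧ ω u q = 0 := by
    rw [← TY_comm hω hd C hp hq hpq nβ nγ', ← hβ, ← hγ', Commute.conj_iff]
    exact ((TY_comm hω hd C hb.ne hb.nf hb.h1f one_ne_zero one_ne_zero).2
      ⟨hω.alt _, hb.h1f⟩).symm
  have c4 : ¬ (ω u p' = 0 ∧ ω u q' = 0) := by
    rw [← TY_comm hω hd C hp' hq' hpq' nβ' nγ', ← hβ', ← hγ', Commute.conj_iff]
    intro hcon
    have := ((TY_comm hω hd C hb.ne hb.nf hb.h1f one_ne_zero one_ne_zero).1 hcon.symm).2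
    rw [hb.h2f] at this
    exact one_ne_zero this
  have hvu : ω v u = 0 := by
    obtain ⟨a, b, rfl⟩ := mem_span_pair.1
      (iso_four hω h4 hp hq hpq (hω.swap0 c1.1) (hω.swap0 c1.2))
    simp [hω.swap0 c3.1, hω.swap0 c3.2]
  obtain ⟨w, hvw, huw, hwp, hwq⟩ : ∃ w, ω v w = 0 ∧ ω u w = 1 ∧ ω w p' = 0 ∧ ω w q' = 0 := by
    by_cases h1 : ω u p' = 0
    · have h2 : ω u q' ≠ 0 := fun h => c4 ⟨h1, h⟩
      exact ⟨(ω u q')⁻¹ • q', by simp [c2.2], by simp [h2], by simp [hω.swap0 hpq'],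
        by simp [hω.alt]⟩
    · exact ⟨(ω u p')⁻¹ • p', by simp [c2.1], by simp [h1], by simp [hω.alt], by simp [hpq']⟩
  have hb' : SB ω v u w := SB.of hω hv hvu hvw huw
  have mp := iso_four hω h4 hv hb'.n2 hvu c1.1 c3.1
  have mq := iso_four hω h4 hv hb'.n2 hvu c1.2 c3.2
  have mp' := iso_four hω h4 hv hb'.nf hvw c2.1 hwp
  have mq' := iso_four hω h4 hv hb'.nf hvw c2.2 hwq
  obtain ⟨s, s1, s2, s3⟩ := SB.trans hω hb hb'
  have key : ∀ X Z, g * X * g⁻¹ = π Z → π s * g * X * (π s * g)⁻¹ = π (s * Z * s⁻¹) := by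
    intro X Z h
    rw [map_mul, map_mul, map_inv, ← h]; group
  refine ⟨s, _, rfl, fun b => ?_, fun b => ?_, fun b => ?_, fun b => ?_⟩
  · obtain ⟨c, hc⟩ := Y_span hω hvw hpq' mp' mq' (β' b)
    exact ⟨c, by rw [key _ _ (hβ' b), hc, Y_conj hω hvw c s s1 s3 hb.h1f]⟩
  · exact ⟨γ' b, by rw [key _ _ (hγ' b), T_conj, s2]⟩
  · exact ⟨γ b, by rw [key _ _ (hγ b), T_conj, s1]⟩
  · obtain ⟨c, hc⟩ := Y_span hω hvu hpq mp mq (β b)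
    exact ⟨c, by rw [key _ _ (hβ b), hc, Y_conj hω hvu c s s1 s2 hb.h12]⟩

end dim4
end AbSp


namespace AbSp
open Submodule

lemma cyc_aux {C : Type*} [CommGroup C] [Finite C] [IsCyclic C] {φ : C} (hφ : ∀ x : C, ∃ n : ℕ, x = φ ^ n)
    (H : Subgroup C) {x : C} (hx : φ * x * x ∈ H) :
    ∃ h ∈ H, ∀ τ ∈ H, ∃ n : ℕ, τ = (φ * (x * h) * (x * h)) ^ n := by
  obtain ⟨t, ht⟩ := IsCyclic.exists_generator (α := H)
  have hgen : ∀ τ ∈ H, ∃ k : ℤ, τ = (t : C) ^ k := by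
    intro τ hτ
    obtain ⟨k, hk⟩ := ht ⟨τ, hτ⟩
    exact ⟨k, by simpa using (congrArg Subtype.val hk).symm⟩
  suffices h : ∃ i : ℤ, φ * (x * (t : C) ^ i) * (x * (t : C) ^ i) = t by
    obtain ⟨i, hi⟩ := h
    refine ⟨(t : C) ^ i, H.zpow_mem t.2 i, fun τ hτ => ?_⟩
    rw [hi]
    obtain ⟨k, hk⟩ := hgen τ hτ
    have h1 : τ ∈ Subgroup.zpowers (t : C) := ⟨k, hk.symm⟩
    rw [← mem_powers_iff_mem_zpowers] at h1
    obtain ⟨n, hn⟩ := h1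
    exact ⟨n, hn.symm⟩
  obtain ⟨m, hm⟩ := hgen _ hx
  have key : ∀ i : ℤ, φ * (x * (t : C) ^ i) * (x * (t : C) ^ i) = (t : C) ^ (m + i + i) := by
    intro i
    rw [zpow_add, zpow_add, ← hm]
    simp only [mul_assoc, mul_comm, mul_left_comm]
  rcases Int.even_or_odd' m with ⟨j, hj | hj⟩
  · have h1 := key (-j)
    rw [hj, show 2 * j + -j + -j = 0 by ring, zpow_zero] at h1
    obtain ⟨n, hn⟩ := hφ (x * (t : C) ^ (-j))
    obtain ⟨n', hn'⟩ := hφ (t : C)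
    rw [hn, ← pow_succ', ← pow_add] at h1
    refine ⟨-n - j, ?_⟩
    rw [key, hj, show 2 * j + (-n - j) + (-n - j) = 1 - ((n + 1 + n : ℕ) : ℤ) by push_cast; ring,
      zpow_sub, zpow_one, zpow_natCast]
    have : (t : C) ^ (n + 1 + n) = 1 := by
      rw [hn', ← pow_mul, mul_comm, pow_mul, h1, one_pow]
    rw [this]; simp
  · refine ⟨-j, ?_⟩
    rw [key, hj, show 2 * j + 1 + -j + -j = 1 by ring, zpow_one]

section dim4b
variable {F V : Type*} [Field F] [AddCommGroup V] [Module F V]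
variable {ω : LinearMap.BilinForm F V} (hω : Form ω)
variable {G : Type*} [Group G] {π : Sp ω →* G}
variable {e₁ e₂ f₂ : V}

/-- Normalised elements. -/
def Nm (π : Sp ω →* G) (hb : SB ω e₁ e₂ f₂) (d : G) (Φ : RingAut F) : Prop :=
  ∃ f1 g1 : F, f1 ≠ 0 ∧ g1 ≠ 0 ∧
    (∀ b, d * π (T hω e₂ b) * d⁻¹ = π (Y hω e₁ f₂ hb.h1f (f1 * Φ b))) ∧
    (∀ a, d * π (Y hω e₁ f₂ hb.h1f a) * d⁻¹ = π (T hω e₂ (g1 * (Φ a) ^ 2)))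

lemma TYE {v w : V} (h : ω v w = 0) (x y : F) :
    T hω v x * Y hω v w h y = E hω v (y • w) (by rw [map_smul, h, smul_zero]) x := by
  unfold T Y
  rw [E_mul]
  exact E_congr hω _ _ rfl (by simp) (by simp)

lemma YTE {v w : V} (h : ω v w = 0) (x y : F) :
    Y hω v w h y * T hω v x = T hω v x * Y hω v w h y := by
  rw [TYE]
  unfold T Y
  rw [E_mul]
  exact E_congr hω _ _ rfl (by simp) (by simp)

lemma TY_left [CharP F 2] {v w : V} (hv : v ≠ 0) (h : ω v w = 0) {x y x' y' : F}
    (he : T hω v x * Y hω v w h y = T hω v x' * Y hω v w h y') : x = x' := by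
  rw [TYE, TYE] at he
  obtain ⟨k, -, hk⟩ := E_eq hω hv _ _ he
  rw [CharTwo.two_eq_zero] at hk
  simpa using hk

lemma rel1 [CharP F 2] (hb : SB ω e₁ e₂ f₂) (a b : F) :
    T hω e₂ b * Y hω e₁ f₂ hb.h1f a * (T hω e₂ b)⁻¹ =
      Y hω e₁ f₂ hb.h1f a * (T hω e₁ (a ^ 2 * b) * Y hω e₁ e₂ hb.h12 (a * b)) := by
  have h1 : ω f₂ e₂ = 1 := by rw [hω.swap, hb.h2f]; exact CharTwo.neg_eq _
  rw [TYE]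
  unfold Y
  rw [E_conj, E_mul]
  refine E_congr hω _ _ ?_ ?_ ?_
  · rw [T_apply, hb.h12]; simp
  · rw [map_smul, T_apply, h1]; module
  · simp only [map_smul, LinearMap.smul_apply, hb.h2f, smul_eq_mul]
    linear_combination -(a ^ 2 * b) * CharTwo.two_eq_zero (R := F)

lemma rel2 [CharP F 2] (hb : SB ω e₁ e₂ f₂) (a b : F) :
    Y hω e₁ f₂ hb.h1f a * T hω e₂ b * (Y hω e₁ f₂ hb.h1f a)⁻¹ =
      T hω e₂ b * (T hω e₁ (b * a ^ 2) * Y hω e₁ e₂ hb.h12 (b * a)) := by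
  rw [TYE, T_conj]
  apply Sp.ext
  intro x
  simp only [Y_apply, T_apply, E_apply, Sp.mul_app, map_add, map_smul, LinearMap.add_apply,
    LinearMap.smul_apply, hb.h12, hb.h2f, hω.swap0 hb.h12, hω.alt, smul_eq_mul]
  module

variable [FiniteDimensional F V] [CharP F 2] [Finite F] [Finite V] [Finite G]

lemma exists_Nm (C : Ctx π) (h4 : Module.finrank F V = 4) {g : G} (hg : ¬ TP hω π g)
    (hb : SB ω e₁ e₂ f₂) : ∃ s Φ, Nm hω π hb (π s * g) Φ := by
  obtain ⟨s, d, rfl, H1, H2, H3, H4⟩ := normalise hω C h4 hg hb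
  refine ⟨s, ?_⟩
  generalize π s * g = d at *
  choose f hf using H1
  choose g' hg' using H2
  choose h hh using H3
  choose k hk using H4
  have inj := C.inj2 hω
  have cm : ∀ x y, d * (x * y) * d⁻¹ = (d * x * d⁻¹) * (d * y * d⁻¹) := by intro x y; group
  have ci : ∀ x, d * x⁻¹ * d⁻¹ = (d * x * d⁻¹)⁻¹ := by intro x; group
  have key : ∀ a b, h (a * b) = g' a * f b ^ 2 := by
    intro a b
    have h1 := congrArg (fun x => d * π x * d⁻¹) (rel1 hω hb a b)
    simp only [map_mul, map_inv, cm, ci, hf, hg', hh, hk] at h1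
    simp only [← map_mul, ← map_inv] at h1
    have h2 := inj h1
    rw [rel2 hω hb] at h2
    have h3 := mul_left_cancel h2
    rw [YTE hω hb.h12] at h3
    exact (TY_left hω hb.ne hb.h12 h3).symm
  have fadd : ∀ a b, f (a + b) = f a + f b := by
    intro a b
    apply Y_inj hω hb.h1f hb.ne hb.nf
    apply inj
    rw [← hf, ← Y_mul, map_mul, ← hf, ← hf, ← cm, ← map_mul, T_mul]
  have finj : Function.Injective f := by
    intro a b hab
    have h1 := hf a
    rw [hab, ← hf] at h1
    simp only [mul_left_inj, mul_right_inj] at h1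
    exact T_inj_right hω hb.ne2 (inj h1)
  have f0 : f 0 = 0 := by simpa using fadd 0 0
  have f1 : f 1 ≠ 0 := fun h => one_ne_zero (finj (h.trans f0.symm))
  have g1 : g' 1 ≠ 0 := by
    intro h0
    have h1 := hg' 1
    rw [h0, T_zero, map_one, mul_inv_eq_one, mul_eq_left, ← map_one π, ← Y_zero hω hb.h1f] at h1
    exact one_ne_zero (Y_inj hω hb.h1f hb.ne hb.nf (inj h1))
  have hg1 : ∀ a, g' a = g' 1 * (f a / f 1) ^ 2 := by
    intro a
    have h1 := key a 1
    have h2 := key 1 a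
    rw [mul_one] at h1
    rw [one_mul, h1] at h2
    field_simp
    exact h2
  have sqi : ∀ x y : F, x ^ 2 = y ^ 2 → x = y := fun x y hxy => frobenius_inj F 2 hxy
  let Φ0 : F →+* F :=
    { toFun := fun a => f a / f 1
      map_one' := div_self f1
      map_zero' := by simp [f0]
      map_add' := fun a b => by rw [fadd, add_div]
      map_mul' := fun a b => by
        apply sqi
        have h1 := key a b
        have h2 := key (a * b) 1
        rw [mul_one, hg1] at h2
        rw [h2, hg1 a] at h1
        field_simp at h1 ⊢
        linear_combination h1 }
  let Φ : RingAut F := RingEquiv.ofBijective Φ0 (Finite.injective_iff_bijective.1 Φ0.injective)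
  have hΦ : ∀ a, Φ a = f a / f 1 := fun _ => rfl
  refine ⟨Φ, f 1, g' 1, f1, g1, fun b => ?_, fun a => ?_⟩
  · rw [hf, hΦ, mul_div_cancel₀ _ f1]
  · rw [hg', hΦ, ← hg1]

omit [FiniteDimensional F V] [CharP F 2] [Finite F] [Finite V] [Finite G] in
lemma Acts.T_conj {g : G} {A : V ≃+ V} {τ : F ≃+* F} {μ : F} (h : Acts π g A τ μ) (v : V) (a : F) :
    g * π (T hω v a) * g⁻¹ = π (T hω (A v) (τ a / μ)) := by
  apply h.conj
  intro x
  rw [T_apply, T_apply, map_add, h.smul, h.form, map_mul]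
  congr 2
  field_simp [h.ne]

omit [FiniteDimensional F V] [CharP F 2] [Finite F] [Finite V] [Finite G] in
lemma Acts.tp {g : G} {A : V ≃+ V} {τ : F ≃+* F} {μ : F} (h : Acts π g A τ μ) : TP hω π g :=
  fun v hv => ⟨A v, by simpa using hv, fun a => ⟨_, h.T_conj hω v a⟩⟩

lemma Nm.sq (hd : Dim3 F V) (C : Ctx π) {hb : SB ω e₁ e₂ f₂} {d : G} {Φ : RingAut F}
    (h : Nm hω π hb d Φ) {A : V ≃+ V} {τ : RingAut F} {μ : F} (hA : Acts π (d * d) A τ μ) :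
    τ = (frobeniusEquiv F 2 : RingAut F) * Φ * Φ := by
  obtain ⟨f1, g1, hf1, hg1, H1, H2⟩ := h
  have h1 : ∀ b, π (T hω (A e₂) (τ b / μ)) = π (T hω e₂ (g1 * Φ (f1 * Φ b) ^ 2)) := by
    intro b
    rw [← hA.T_conj, ← H2, ← H1]; group
  obtain ⟨k, hk⟩ := mem_span_singleton.1 (T_same hω hd C (by
    rw [map_one]; exact div_ne_zero one_ne_zero hA.ne) (h1 1))
  have h2 : ∀ b, τ b / μ * k ^ 2 = g1 * Φ (f1 * Φ b) ^ 2 := by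
    intro b
    have h3 := h1 b
    rw [← hk, T_smul] at h3
    exact T_inj_right hω hb.ne2 (C.inj2 hω h3)
  have h3 := h2 1
  apply RingEquiv.ext
  intro b
  have h4 := h2 b
  change τ b = frobeniusEquiv F 2 (Φ (Φ b))
  rw [frobeniusEquiv_apply, frobenius_def]
  simp only [map_one, map_mul, mul_one] at h3 h4
  have h5 : g1 * Φ f1 ^ 2 ≠ 0 := mul_ne_zero hg1 (pow_ne_zero 2 (by simpa using hf1))
  apply mul_left_cancel₀ h5
  linear_combination h4 - τ b * h3

omit [FiniteDimensional F V] [CharP F 2] [Finite F] [Finite V] [Finite G] in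
lemma Nm.mul {hb : SB ω e₁ e₂ f₂} {d : G} {Φ : RingAut F} (h : Nm hω π hb d Φ) {κ : G}
    {A : V ≃+ V} {τ : RingAut F} {μ : F} (hA : Acts π κ A τ μ) (a1 : A e₁ = e₁) (a2 : A e₂ = e₂)
    (a3 : A f₂ = f₂) : Nm hω π hb (d * κ) (Φ * τ) := by
  have hμ : μ = 1 := by
    have := hA.form e₂ f₂
    rw [a2, a3, hb.h2f] at this
    simpa using this.symm
  obtain ⟨f1, g1, hf1, hg1, H1, H2⟩ := h
  refine ⟨f1, g1, hf1, hg1, fun b => ?_, fun a => ?_⟩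
  · have h1 := hA.T_conj hω e₂ b
    rw [a2, hμ, div_one] at h1
    change _ = π (Y hω e₁ f₂ hb.h1f (f1 * Φ (τ b)))
    rw [← H1, ← h1]; group
  · have h1 := hA.conj (Y hω e₁ f₂ hb.h1f a) (Y hω e₁ f₂ hb.h1f (τ a)) (by
      intro x
      have h2 := hA.form x e₁
      have h3 := hA.form x f₂
      rw [a1, hμ, one_mul] at h2
      rw [a3, hμ, one_mul] at h3
      rw [Y_apply, Y_apply, map_add, map_add, hA.smul, hA.smul, a1, a3, h2, h3, map_mul, map_mul])
    change _ = π (T hω e₂ (g1 * (Φ (τ a)) ^ 2))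
    rw [← H2, ← h1]; group

end dim4b

section std4
variable {F : Type*} [Field F] [Finite F] [CharP F 2]
variable {G : Type*} [Group G] [Finite G] {π : Sp (stdForm F (Fin 2)) →* G}

lemma sb_std : SB (stdForm F (Fin 2)) (Pi.single (Sum.inl 0) 1) (Pi.single (Sum.inl 1) 1)
    (Pi.single (Sum.inr 1) 1) := by
  apply SB.of stdForm_form
  · simp
  · rw [stdForm_apply]; simp
  · rw [stdForm_apply]; simp
  · rw [stdForm_apply]; simp [CharTwo.neg_eq]

theorem supp_four (C : Ctx π) {g0 : G} (hg0 : ¬ TP stdForm_form π g0) :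
    ∃ A : Subgroup G, (∀ x y : A, (x : G) * y = (y : G) * x) ∧ A ⊔ π.range = ⊤ := by
  have hω := stdForm_form (F := F) (n := Fin 2)
  have h4 : Module.finrank F (Fin 2 ⊕ Fin 2 → F) = 4 := by simp
  have hd : Dim3 F (Fin 2 ⊕ Fin 2 → F) := dim3_of_finrank (by omega)
  have fsq : ∀ x : F, ∃ r, x = r ^ 2 := by
    intro x
    obtain ⟨r, hr⟩ := FiniteField.isSquare_of_char_two (CharP.ringChar_of_prime_eq_zero Nat.prime_two
      (by exact CharP.cast_eq_zero F 2)) x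
    exact ⟨r, by rw [hr]; ring⟩
  have fsq2 : ∀ x y : F, x ≠ 0 → y ≠ 0 → ∃ r, r ≠ 0 ∧ x = r ^ 2 * y := by
    intro x y hx hy
    obtain ⟨r, hr⟩ := fsq (x / y)
    rw [div_eq_iff hy] at hr
    exact ⟨r, by rintro rfl; exact hx (by simpa using hr), hr⟩
  obtain ⟨s, Φ, hN⟩ := exists_Nm hω C h4 hg0 sb_std
  have mulTP : ∀ x y, TP hω π x → TP hω π (x * y) → TP hω π y := by
    intro x y hx hxy
    simpa using (hx.inv hω).mul hω hxy
  have mulTP' : ∀ x y, TP hω π y → TP hω π (x * y) → TP hω π x := by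
    intro x y hx hxy
    simpa using hxy.mul hω (hx.inv hω)
  have hd0 : ¬ TP hω π (π s * g0) := fun h => hg0 (mulTP _ _ (TP.of_range hω s) h)
  set d := π s * g0
  have hsq : (frobeniusEquiv F 2 : RingAut F) * Φ * Φ ∈ autH π := by
    obtain ⟨A, τ, μ, hA⟩ := (TP_of_two hω C h4 hd0 hd0).acts hω hd C
    rw [← hN.sq hω hd C hA]
    exact ⟨_, _, _, hA⟩
  have : Finite (RingAut F) := Finite.of_injective (fun τ : RingAut F => (τ : F → F))
      fun a b h => RingEquiv.ext (congrFun h)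
  let _ : CommGroup (RingAut F) := IsCyclic.commGroup
  obtain ⟨h, hh, hgen⟩ := cyc_aux (C := RingAut F) (aut_frob F 2) (autH π) hsq
  obtain ⟨g1, A1, μ1, h1⟩ := hh
  obtain ⟨r, hr, hrμ⟩ := fsq2 1 μ1 one_ne_zero h1.ne
  obtain ⟨s1, hκ⟩ := h1.realize hr (B := dg h 1 one_ne_zero) (by
    rw [← hrμ]; exact dg_SS h 1 one_ne_zero)
  set κ := π s1 * g1
  have fix : ∀ j : Fin 2 ⊕ Fin 2, dg h 1 one_ne_zero (Pi.single j 1) = (Pi.single j 1 : _ → F) := by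
    intro j
    ext (i | i)
    · rw [dg_inl, Pi.single_apply]; split_ifs <;> simp
    · rw [dg_inr, Pi.single_apply]; split_ifs <;> simp
  have hN' := hN.mul hω hκ (fix _) (fix _) (fix _)
  have hδ : ¬ TP hω π (d * κ) := fun h => hd0 (mulTP' _ _ (hκ.tp hω) h)
  set δ := d * κ
  obtain ⟨A2, τ2, μ2, hA2⟩ := (TP_of_two hω C h4 hδ hδ).acts hω hd C
  have hτ2 := hN'.sq hω hd C hA2
  rw [← hτ2] at hgen
  have main : ∀ g, TP hω π g → g ∈ Subgroup.zpowers δ ⊔ π.range := by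
    intro g hg
    obtain ⟨A, τ, μ, hA⟩ := hg.acts hω hd C
    obtain ⟨n, rfl⟩ := hgen τ ⟨_, _, _, hA⟩
    obtain ⟨A', μ', hA'⟩ := hA2.pow n
    obtain ⟨r, -, hr⟩ := fsq2 μ μ' hA.ne hA'.ne
    obtain ⟨s, rfl⟩ := hA.coset C hA' hr
    have hm := Subgroup.mem_zpowers δ
    exact mul_mem (le_sup_right (a := Subgroup.zpowers δ) ⟨s, rfl⟩)
      (le_sup_left (b := π.range) (pow_mem (mul_mem hm hm) n))
  refine ⟨Subgroup.zpowers δ, ?_, ?_⟩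
  · rintro ⟨x, i, rfl⟩ ⟨y, j, rfl⟩
    simp only [← zpow_add, add_comm]
  · rw [eq_top_iff]
    intro g _
    by_cases hg : TP hω π g
    · exact main g hg
    · have h2 := main _ (TP_of_two hω C h4 hg (not_TP_inv hω hδ))
      have h3 := mul_mem h2 (le_sup_left (b := π.range) (Subgroup.mem_zpowers δ))
      simpa using h3

end std4
end AbSp


namespace AbSp
open Submodule Matrix

theorem supp_std {F : Type*} [Field F] [Finite F] {G : Type*} [Group G] [Finite G] (l : ℕ)
    (hl : 2 ≤ l) {π : Sp (stdForm F (Fin l)) →* G} (C : Ctx π) :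
    ∃ A : Subgroup G, (∀ x y : A, (x : G) * y = (y : G) * x) ∧ A ⊔ π.range = ⊤ := by
  have hω := stdForm_form (F := F) (n := Fin l)
  have hfr : Module.finrank F (Fin l ⊕ Fin l → F) = l + l := by simp
  have hd : Dim3 F (Fin l ⊕ Fin l → F) := dim3_of_finrank (by omega)
  by_cases h2 : (2 : F) = 0
  · have hch : CharP F 2 := CharTwo.of_one_ne_zero_of_two_eq_zero one_ne_zero h2
    by_cases hall : ∀ g, TP hω π g
    · exact supp_acts C fun g => (hall g).acts hω hd C
    · push Not at hall
      obtain ⟨g, hg⟩ := hall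
      have h4 := ((type_cases hω C (by omega) g).resolve_left hg).1
      obtain rfl : l = 2 := by omega
      exact supp_four C hg
  · have : Nontrivial (Fin l ⊕ Fin l → F) :=
      Module.nontrivial_of_finrank_pos (R := F) (by omega)
    exact supp_acts C fun g => (TP_odd hω C h2 g).acts hω hd C

section mat
variable {F : Type*} [Field F] {n : Type*} [Fintype n] [DecidableEq n]

lemma stdForm_J (x y : n ⊕ n → F) : stdForm F n x y = x ⬝ᵥ (J n F *ᵥ y) := by
  rw [stdForm_apply, J, fromBlocks_mulVec, dotProduct, Fintype.sum_sum_type]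
  simp [Finset.sum_add_distrib, Finset.sum_sub_distrib, neg_mulVec]
  ring

lemma mem_symp_iff (A : Matrix (n ⊕ n) (n ⊕ n) F) : A ∈ symplecticGroup n F ↔
    ∀ x y, stdForm F n (A *ᵥ x) (A *ᵥ y) = stdForm F n x y := by
  have key : ∀ x y, stdForm F n (A *ᵥ x) (A *ᵥ y) = x ⬝ᵥ ((Aᵀ * J n F * A) *ᵥ y) := by
    intro x y
    rw [stdForm_J, ← mulVec_mulVec, ← mulVec_mulVec, dotProduct_mulVec x, vecMul_transpose]
  rw [SymplecticGroup.mem_iff']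
  constructor
  · intro h x y
    rw [key, h, stdForm_J]
  · intro h
    ext i j
    have := h (Pi.single i 1) (Pi.single j 1)
    rw [key, stdForm_J] at this
    simpa using this

/-- Matrices of isometries. -/
def toSymp : Sp (stdForm F n) →* symplecticGroup n F where
  toFun s := ⟨LinearMap.toMatrix' s.1.toLinearMap, by
    rw [mem_symp_iff]
    intro x y
    rw [LinearMap.toMatrix'_mulVec, LinearMap.toMatrix'_mulVec]
    exact Sp.iso s x y⟩
  map_one' := by apply Subtype.ext; exact LinearMap.toMatrix'_one
  map_mul' s t := by apply Subtype.ext; exact LinearMap.toMatrix'_mul _ _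

lemma toSymp_mulVec (s : Sp (stdForm F n)) (x : n ⊕ n → F) :
    (toSymp s).1 *ᵥ x = s.1 x := LinearMap.toMatrix'_mulVec _ _

lemma toSymp_surj : Function.Surjective (toSymp (F := F) (n := n)) := by
  intro A
  have h1 : ∀ x, (A⁻¹).1 *ᵥ (A.1 *ᵥ x) = x := by
    intro x
    have := congrArg Subtype.val (inv_mul_cancel A)
    rw [mulVec_mulVec]
    change ((A⁻¹ * A : symplecticGroup n F).1) *ᵥ x = x
    rw [this]; exact one_mulVec x
  have h2 : ∀ x, A.1 *ᵥ ((A⁻¹).1 *ᵥ x) = x := by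
    intro x
    have := congrArg Subtype.val (mul_inv_cancel A)
    rw [mulVec_mulVec]
    change ((A * A⁻¹ : symplecticGroup n F).1) *ᵥ x = x
    rw [this]; exact one_mulVec x
  let f : (n ⊕ n → F) ≃ₗ[F] (n ⊕ n → F) := LinearEquiv.ofLinear (toLin' A.1) (toLin' (A⁻¹).1)
    (by apply LinearMap.ext; intro x; exact h2 x) (by apply LinearMap.ext; intro x; exact h1 x)
  refine ⟨⟨f, ?_⟩, ?_⟩
  · exact (mem_symp_iff A.1).1 A.2
  · apply Subtype.ext
    exact LinearMap.toMatrix'_toLin' A.1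

lemma toSymp_inj : Function.Injective (toSymp (F := F) (n := n)) := by
  intro s t h
  apply Sp.ext
  intro x
  rw [← toSymp_mulVec, ← toSymp_mulVec, h]

lemma toSymp_center (s : Sp (stdForm F n)) :
    toSymp s ∈ Subgroup.center (symplecticGroup n F) ↔ ∃ c : F, ∀ x, s.1 x = c • x := by
  rw [Subgroup.mem_center_iff]
  constructor
  · intro h
    have hc : ∀ t, t * s = s * t := fun t => toSymp_inj (by rw [map_mul, map_mul, h])
    apply scalar_of_span (φ := s.1.toLinearMap)
    intro x
    change s.1 x ∈ _
    by_cases hx : x = 0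
    · simp [hx]
    have hω := stdForm_form (F := F) (n := n)
    obtain ⟨y, hy⟩ := hω.exists_pair (x := s.1 x) (by simpa using hx)
    have h1 : T hω (s.1 x) 1 = T hω x 1 := by
      rw [← T_conj, ← hc, mul_inv_cancel_right]
    have h2 := congrArg (fun t : Sp (stdForm F n) => t.1 y) h1
    simp only [T_apply, hy, add_right_inj] at h2
    rw [mem_span_singleton]
    exact ⟨_, by rw [← h2]; simp⟩
  · rintro ⟨c, hc⟩ t
    obtain ⟨t, rfl⟩ := toSymp_surj t
    rw [← map_mul, ← map_mul]
    congr 1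
    apply Sp.ext
    intro x
    rw [Sp.mul_app, Sp.mul_app, hc, hc, map_smul]

end mat
end AbSp

theorem abelian_supplements_stmt_16
    (l q : ℕ) (hl : 2 ≤ l) (F : Type*) [Field F] [Fintype F] (hcard : Fintype.card F = q)
    (G : Type*) [Group G] [Finite G] (G₀ : Subgroup G) [G₀.Normal]
    (hsimple : IsSimpleGroup G₀) (hnonab : ∃ x y : G₀, x * y ≠ y * x)
    (hcent : Subgroup.centralizer (G₀ : Set G) = ⊥)
    (hiso : Nonempty (G₀ ≃* (Matrix.symplecticGroup (Fin l) F ⧸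
      Subgroup.center (Matrix.symplecticGroup (Fin l) F)))) :
    ∃ A : Subgroup G, (∀ x y : A, (x : G) * y = (y : G) * x) ∧ A ⊔ G₀ = ⊤ := by
  obtain ⟨e⟩ := hiso
  let π : AbSp.Sp (AbSp.stdForm F (Fin l)) →* G :=
    (G₀.subtype.comp (e.symm : _ →* G₀)).comp
      ((QuotientGroup.mk' (Subgroup.center (Matrix.symplecticGroup (Fin l) F))).comp AbSp.toSymp)
  have hπ : ∀ s, π s = (e.symm (QuotientGroup.mk' _ (AbSp.toSymp s)) : G₀) := fun _ => rfl
  have hrange : π.range = G₀ := by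
    ext g
    constructor
    · rintro ⟨s, rfl⟩
      rw [hπ]; exact Subtype.property _
    · intro hg
      obtain ⟨A, hA⟩ := QuotientGroup.mk'_surjective _ (e ⟨g, hg⟩)
      obtain ⟨s, rfl⟩ := AbSp.toSymp_surj A
      exact ⟨s, by rw [hπ, hA]; simp⟩
  have C : AbSp.Ctx π := by
    refine ⟨?_, ?_, ?_⟩
    · intro s
      rw [← AbSp.toSymp_center, hπ, OneMemClass.coe_eq_one, map_eq_one_iff _ e.symm.injective]
      exact QuotientGroup.eq_one_iff _
    · rw [hrange]; infer_instance
    · intro g hg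
      have : g ∈ Subgroup.centralizer (G₀ : Set G) := by
        rw [Subgroup.mem_centralizer_iff]
        intro h hh
        rw [← hrange] at hh
        obtain ⟨s, rfl⟩ := hh
        exact (hg s).symm
      rw [hcent] at this
      simpa using this
  obtain ⟨A, h1, h2⟩ := AbSp.supp_std l hl C
  exact ⟨A, h1, by rw [← hrange]; exact h2⟩
end

section
/- Let V be a vector space over a field of characteristic 0 (e.g. the reals), let α₁,…,αₙ and ω₁,…,ωₙ be vectors in V, and let s₁,…,sₙ be linear endomorphisms of V such that sᵢ(ω_j) = ω_j − δ_{ij}·αᵢ for all i, j (where δ is the Kronecker delta) and such that for all k, j the vector s_k(α_j) − α_j is an integer multiple of α_k. Then for each i, the vector (ωᵢ − (s₁ ∘ s₂ ∘ ⋯ ∘ sₙ)(ωᵢ)) − αᵢ lies in the ℤ-span of {α₁, …, α_{i−1}}; in particular ωᵢ − (s₁ ∘ ⋯ ∘ sₙ)(ωᵢ) lies in the ℤ-span of {α₁, …, αᵢ}. -/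
theorem prod_fix {k V : Type*} [Field k] [AddCommGroup V] [Module k V]
    {n : ℕ} (α ω : Fin n → V) (s : Fin n → Module.End k V)
    (hs : ∀ i j, s i (ω j) = ω j - if i = j then α i else 0) (i : Fin n)
    (l : List (Fin n)) (hi : i ∉ l) : (l.map s).prod (ω i) = ω i := by
  induction l with
  | nil => simp
  | cons a t ih =>
    simp only [List.mem_cons, not_or] at hi
    simp only [List.map_cons, List.prod_cons, Module.End.mul_apply]
    rw [ih hi.2, hs, if_neg (Ne.symm hi.1), sub_zero]

theorem s_preserves {k V : Type*} [Field k] [AddCommGroup V] [Module k V]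
    {n : ℕ} (α : Fin n → V) (s : Fin n → Module.End k V)
    (hroot : ∀ i j, ∃ z : ℤ, s i (α j) - α j = z • α i) (i a : Fin n) (ha : a < i)
    (x : V) (hx : x ∈ Submodule.span ℤ (α '' {j | j < i})) :
    s a x ∈ Submodule.span ℤ (α '' {j | j < i}) := by
  induction hx using Submodule.span_induction with
  | mem x h =>
    obtain ⟨j, hj, rfl⟩ := h
    obtain ⟨z, hz⟩ := hroot a j
    rw [sub_eq_iff_eq_add.mp hz]
    exact add_mem (Submodule.smul_mem _ _ (Submodule.subset_span ⟨a, ha, rfl⟩))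
      (Submodule.subset_span ⟨j, hj, rfl⟩)
  | zero => simp
  | add x y _ _ hx hy => rw [map_add]; exact add_mem hx hy
  | smul c x _ hx => rw [map_zsmul]; exact Submodule.smul_mem _ _ hx

theorem cox_prod_mem {k V : Type*} [Field k] [AddCommGroup V] [Module k V]
    {n : ℕ} (α ω : Fin n → V) (s : Fin n → Module.End k V)
    (hs : ∀ i j, s i (ω j) = ω j - if i = j then α i else 0)
    (hroot : ∀ i j, ∃ z : ℤ, s i (α j) - α j = z • α i) (i : Fin n)
    (l : List (Fin n)) (hl : l.Pairwise (· < ·)) (hi : i ∈ l) :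
    (ω i - (l.map s).prod (ω i)) - α i ∈ Submodule.span ℤ (α '' {j | j < i}) := by
  induction l with
  | nil => simp at hi
  | cons a t ih =>
    rw [List.pairwise_cons] at hl
    simp only [List.map_cons, List.prod_cons, Module.End.mul_apply]
    by_cases hai : a = i
    · subst hai
      have : a ∉ t := fun h => lt_irrefl _ (hl.1 a h)
      rw [prod_fix α ω s hs a t this, hs]
      simp
    · have hit : i ∈ t := (List.mem_cons.mp hi).resolve_left (Ne.symm hai)
      have hlt := hl.1 i hit
      have h1 := s_preserves α s hroot i a hlt _ (ih hl.2 hit)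
      obtain ⟨z, hz⟩ := hroot a i
      have h2 : z • α a ∈ Submodule.span ℤ (α '' {j | j < i}) :=
        Submodule.smul_mem _ _ (Submodule.subset_span ⟨a, hlt, rfl⟩)
      rw [← hz] at h2
      have h3 := add_mem h1 h2
      rw [map_sub, map_sub, hs, if_neg hai, sub_zero] at h3
      convert h3 using 1
      abel

/-- Coxeter element lemma: with simple reflections `sᵢ`, fundamental weights `ωᵢ` and simple
roots `αᵢ`, `(1 − s₁⋯sₙ)ωᵢ − αᵢ` lies in the ℤ-span of `α₁,…,α_{i−1}`; in particular
`(1 − s₁⋯sₙ)ωᵢ` lies in the ℤ-span of `α₁,…,αᵢ`. -/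
theorem abelian_supplements_stmt_17
    (k : Type*) [Field k] [CharZero k] (V : Type*) [AddCommGroup V] [Module k V]
    (n : ℕ) (α ω : Fin n → V) (s : Fin n → Module.End k V)
    (hs : ∀ i j, s i (ω j) = ω j - if i = j then α i else 0)
    (hroot : ∀ i j, ∃ z : ℤ, s i (α j) - α j = z • α i) :
    ∀ i : Fin n,
      (ω i - (List.ofFn s).prod (ω i)) - α i ∈
        Submodule.span ℤ (α '' {j | j < i}) ∧
      ω i - (List.ofFn s).prod (ω i) ∈ Submodule.span ℤ (α '' {j | j ≤ i}) := by
  intro i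
  have h := cox_prod_mem α ω s hs hroot i (List.finRange n) (List.pairwise_lt_finRange n)
    (List.mem_finRange i)
  rw [← List.ofFn_eq_map] at h
  refine ⟨h, ?_⟩
  have h1 : Submodule.span ℤ (α '' {j | j < i}) ≤ Submodule.span ℤ (α '' {j | j ≤ i}) :=
    Submodule.span_mono (Set.image_mono fun j (hj : j < i) => show j ≤ i from le_of_lt hj)
  have h2 : α i ∈ Submodule.span ℤ (α '' {j | j ≤ i}) :=
    Submodule.subset_span ⟨i, le_refl i, rfl⟩
  simpa using add_mem (h1 h) h2
end

section
/- Let t ≥ 1 and let σ, τ be permutations of {1,…,t} such that the subgroup of the symmetric group generated by σ and τ is abelian and acts transitively on {1,…,t}. Let Z be an abelian group. Then for every tuple (z₁,…,z_t) ∈ Z^t with z₁·z₂·⋯·z_t = 1 there exist tuples (n₁,…,n_t) and (m₁,…,m_t) in Z^t such that z_i = n_{τ⁻¹(i)} · n_i⁻¹ · m_i · m_{σ⁻¹(i)}⁻¹ for every i; equivalently, (z₁,…,z_t) = [τ, n]·[m, σ] computed in the wreath product Z ≀ Sym(t), where Sym(t) acts on Z^t by permuting coordinates. -/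
/-- If `⟨σ,τ⟩ ≤ Sym(t)` is abelian and transitive and `Z` is an abelian group, then every
tuple `z ∈ Z^t` with product `1` can be written as `[τ,n]·[m,σ]` in the wreath product,
i.e. `z i = n (τ⁻¹ i) · (n i)⁻¹ · m i · (m (σ⁻¹ i))⁻¹` for all `i`. -/
theorem abelian_supplements_stmt_19
    (t : ℕ) (ht : 1 ≤ t) (σ τ : Equiv.Perm (Fin t))
    (habel : ∀ x ∈ Subgroup.closure {σ, τ}, ∀ y ∈ Subgroup.closure {σ, τ}, x * y = y * x)
    (htrans : ∀ i j : Fin t, ∃ π ∈ Subgroup.closure {σ, τ}, π i = j)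
    (Z : Type*) [CommGroup Z] (z : Fin t → Z) (hz : ∏ i, z i = 1) :
    ∃ n m : Fin t → Z, ∀ i,
      z i = n (τ⁻¹ i) * (n i)⁻¹ * (m i * (m (σ⁻¹ i))⁻¹) := by
  classical
  let R : Subgroup (Fin t → Z) :=
    { carrier := {w | ∃ n m : Fin t → Z, ∀ i,
        w i = n (τ⁻¹ i) * (n i)⁻¹ * (m i * (m (σ⁻¹ i))⁻¹)}
      one_mem' := ⟨1, 1, fun i => by simp⟩
      mul_mem' := by
        rintro a b ⟨n, m, h⟩ ⟨n', m', h'⟩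
        refine ⟨n * n', m * m', fun i => ?_⟩
        simp only [Pi.mul_apply, h, h', mul_inv]
        simp only [mul_assoc, mul_comm, mul_left_comm]
      inv_mem' := by
        rintro a ⟨n, m, h⟩
        refine ⟨n⁻¹, m⁻¹, fun i => ?_⟩
        simp only [Pi.inv_apply, h, mul_inv] }
  have key : ∀ (π : Equiv.Perm (Fin t)) (i : Fin t) (a : Z) (j : Fin t),
      (Pi.mulSingle i a : Fin t → Z) (π⁻¹ j) = (Pi.mulSingle (π i) a : Fin t → Z) j := by
    intro π i a j
    simp only [Pi.mulSingle_apply, Equiv.Perm.inv_eq_iff_eq]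
  have hmove : ∀ π ∈ Subgroup.closure {σ, τ}, ∀ (i : Fin t) (a : Z),
      (Pi.mulSingle (π i) a * (Pi.mulSingle i a)⁻¹ : Fin t → Z) ∈ R := by
    intro π hπ
    induction hπ using Subgroup.closure_induction with
    | mem x hx =>
      intro i a
      rcases hx with rfl | hx
      · refine ⟨1, (Pi.mulSingle i a)⁻¹, fun j => ?_⟩
        simp only [Pi.mul_apply, Pi.inv_apply, key, Pi.one_apply]
        simp [mul_comm]
      · rcases hx with rfl
        refine ⟨Pi.mulSingle i a, 1, fun j => ?_⟩
        simp only [Pi.mul_apply, Pi.inv_apply, key, Pi.one_apply]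
        simp
    | one => intro i a; simpa using R.one_mem
    | mul x y _ _ hx hy =>
      intro i a
      simpa using R.mul_mem (hx (y i) a) (hy i a)
    | inv x _ hx =>
      intro i a
      simpa using R.inv_mem (hx (x⁻¹ i) a)
  let o : Fin t := ⟨0, ht⟩
  have hdec : z = ∏ i, (Pi.mulSingle i (z i) * (Pi.mulSingle o (z i))⁻¹ : Fin t → Z) := by
    have h2 : (∏ i, Pi.mulSingle o (z i) : Fin t → Z) = 1 := by
      have := map_prod (MonoidHom.mulSingle (fun _ : Fin t => Z) o) z Finset.univ
      rw [hz, map_one] at this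
      exact this.symm
    rw [Finset.prod_mul_distrib, Finset.prod_inv_distrib, h2, Finset.univ_prod_mulSingle]
    simp
  have hzR : z ∈ R := by
    rw [hdec]
    refine R.prod_mem fun i _ => ?_
    obtain ⟨π, hπ, h⟩ := htrans o i
    have := hmove π hπ o (z i)
    rwa [h] at this
  exact hzR
end
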